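/- arXiv:2204.04337 — 4 statements merged into one kernel-verified Lean document; each statement's English description precedes it below -/
import Mathlib

section
/- Fix integers n ≥ 1 and k ≥ 0. There exist constants C > c > 0 and t₀ > 0 such that for all t > t₀: c·t^{−n−k} ≤ 𝓕^{(t)}_{n+k} Φ^{(t)}_{n,k}(0) ≤ C·t^{−n−k}, and ∫_0^1 Φ^{(t)}_{n,k}(s)·s^{n+k−1}·(1−s)^{t/4} ds ≤ C·t^{−n−k}. -/
open MeasureTheory

/-- `𝓕^{(t)}_m φ(s) = ∫_s^1 r^{m−1} φ(r) (1−r)^t dr`. -/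
noncomputable def Ft (t : ℝ) (m : ℕ) (φ : ℝ → ℝ) (s : ℝ) : ℝ :=
  ∫ r in Set.Ioo s 1, r ^ (m - 1) * φ r * (1 - r) ^ t

/-- `𝓖^{(t)}_m φ(s) = 𝓕^{(t)}_m φ(s) / (s^m (1−s)^{t+1})`. -/
noncomputable def Gt (t : ℝ) (m : ℕ) (φ : ℝ → ℝ) (s : ℝ) : ℝ :=
  Ft t m φ s / (s ^ m * (1 - s) ^ (t + 1))

/-- `Φ^{(t)}_{n,0} ≡ 1` and `Φ^{(t)}_{n,k+1}(s) = (1−s) (𝓖^{(t)}_{n+k})² Φ^{(t)}_{n,k}(s)`. -/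
noncomputable def Phi (t : ℝ) (n : ℕ) : ℕ → ℝ → ℝ
  | 0 => fun _ => 1
  | k + 1 => fun s => (1 - s) * Gt t (n + k) (Gt t (n + k) (Phi t n k)) s

open Set

noncomputable def Mom (p : ℕ) (q : ℝ) (φ : ℝ → ℝ) : ENNReal :=
  ∫⁻ x in Ioo (0:ℝ) 1, ENNReal.ofReal (x ^ p * (1 - x) ^ q * φ x)

lemma tri_swap (f g : ℝ → ENNReal) (hf : Measurable f) (hg : Measurable g) :
    ∫⁻ r in Ioo (0:ℝ) 1, (∫⁻ x in Ioo r 1, f x) * g r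
      = ∫⁻ x in Ioo (0:ℝ) 1, f x * ∫⁻ r in Ioo (0:ℝ) x, g r := by
  have hS : MeasurableSet {z : ℝ × ℝ | 0 < z.1 ∧ z.1 < z.2 ∧ z.2 < 1} :=
    (measurableSet_lt measurable_const measurable_fst).inter
      ((measurableSet_lt measurable_fst measurable_snd).inter
        (measurableSet_lt measurable_snd measurable_const))
  let K : ℝ → ℝ → ENNReal := fun r x =>
    indicator {z : ℝ × ℝ | 0 < z.1 ∧ z.1 < z.2 ∧ z.2 < 1} (fun z => f z.2 * g z.1) (r, x)
  have hK : Measurable (Function.uncurry K) := by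
    have : Function.uncurry K = indicator {z : ℝ × ℝ | 0 < z.1 ∧ z.1 < z.2 ∧ z.2 < 1}
        (fun z => f z.2 * g z.1) := by ext z; rfl
    rw [this]
    exact ((hf.comp measurable_snd).mul (hg.comp measurable_fst)).indicator hS
  have h1 : ∫⁻ r in Ioo (0:ℝ) 1, (∫⁻ x in Ioo r 1, f x) * g r = ∫⁻ r, ∫⁻ x, K r x := by
    rw [← lintegral_indicator measurableSet_Ioo]
    congr 1; ext r
    by_cases hr : r ∈ Ioo (0:ℝ) 1
    · rw [indicator_of_mem hr, ← lintegral_mul_const _ hf, ← lintegral_indicator measurableSet_Ioo]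
      congr 1; ext x
      simp only [K, indicator, mem_Ioo, mem_ofPred_eq, hr.1, true_and]
    · rw [indicator_of_notMem hr, eq_comm, lintegral_eq_zero_iff' (by
        exact (hK.comp (measurable_prodMk_left)).aemeasurable)]
      refine Filter.Eventually.of_forall fun x => ?_
      simp only [K]
      rw [indicator_of_notMem]; rfl
      rintro ⟨a, b, c⟩
      exact hr ⟨a, b.trans c⟩
  have h2 : ∫⁻ x in Ioo (0:ℝ) 1, f x * ∫⁻ r in Ioo (0:ℝ) x, g r = ∫⁻ x, ∫⁻ r, K r x := by
    rw [← lintegral_indicator measurableSet_Ioo]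
    congr 1; ext x
    by_cases hr : x ∈ Ioo (0:ℝ) 1
    · rw [indicator_of_mem hr, ← lintegral_const_mul _ hg, ← lintegral_indicator measurableSet_Ioo]
      congr 1; ext r
      simp only [K, indicator, mem_Ioo, mem_ofPred_eq, hr.2, and_true]
    · rw [indicator_of_notMem hr, eq_comm, lintegral_eq_zero_iff' (by
        exact (hK.comp (measurable_prodMk_right)).aemeasurable)]
      refine Filter.Eventually.of_forall fun r => ?_
      simp only [K]
      rw [indicator_of_notMem]; rfl
      rintro ⟨a, b, c⟩
      exact hr ⟨a.trans b, c⟩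
  rw [h1, h2, lintegral_lintegral_swap hK.aemeasurable]

lemma Ft_meas (t : ℝ) (m : ℕ) (φ : ℝ → ℝ) (hφ : Measurable φ) : Measurable (Ft t m φ) := by
  have hS : MeasurableSet {z : ℝ × ℝ | z.1 < z.2 ∧ z.2 < 1} :=
      ((measurableSet_lt measurable_fst measurable_snd).inter
        (measurableSet_lt measurable_snd measurable_const))
  have hm : Measurable (indicator {z : ℝ × ℝ | z.1 < z.2 ∧ z.2 < 1}
      (fun z => z.2 ^ (m - 1) * φ z.2 * (1 - z.2) ^ t)) := by
    refine Measurable.indicator ?_ hS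
    have : Measurable (fun r : ℝ => r ^ (m - 1) * φ r * (1 - r) ^ t) := by fun_prop
    exact this.comp measurable_snd
  have h := (hm.stronglyMeasurable.integral_prod_right' (ν := volume)).measurable
  convert h using 1
  ext s
  rw [Ft, ← integral_indicator measurableSet_Ioo]
  congr 1

lemma Gt_meas (t : ℝ) (m : ℕ) (φ : ℝ → ℝ) (hφ : Measurable φ) : Measurable (Gt t m φ) := by
  have := Ft_meas t m φ hφ
  unfold Gt
  fun_prop

lemma Ft_nonneg (t : ℝ) (m : ℕ) (φ : ℝ → ℝ) (h0 : ∀ x ∈ Ioo (0:ℝ) 1, 0 ≤ φ x)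
    (s : ℝ) (hs : 0 ≤ s) : 0 ≤ Ft t m φ s := by
  refine setIntegral_nonneg measurableSet_Ioo fun r hr => ?_
  have hr0 : 0 < r := hs.trans_lt hr.1
  have := h0 r ⟨hr0, hr.2⟩
  have : 0 < 1 - r := by linarith [hr.2]
  positivity

lemma Gt_nonneg (t : ℝ) (m : ℕ) (φ : ℝ → ℝ) (h0 : ∀ x ∈ Ioo (0:ℝ) 1, 0 ≤ φ x) :
    ∀ x ∈ Ioo (0:ℝ) 1, 0 ≤ Gt t m φ x := by
  intro x hx
  have := Ft_nonneg t m φ h0 x hx.1.le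
  have : 0 < 1 - x := by linarith [hx.2]
  have := hx.1
  unfold Gt
  positivity

lemma Phi_meas (t : ℝ) (n k : ℕ) : Measurable (Phi t n k) := by
  induction k with
  | zero => exact measurable_const
  | succ k ih =>
    have := Gt_meas t (n+k) _ (Gt_meas t (n+k) _ ih)
    unfold Phi
    fun_prop

lemma Phi_nonneg (t : ℝ) (n k : ℕ) : ∀ x ∈ Ioo (0:ℝ) 1, 0 ≤ Phi t n k x := by
  induction k with
  | zero => intro x _; exact zero_le_one
  | succ k ih =>
    intro x hx
    have := Gt_nonneg t (n+k) _ (Gt_nonneg t (n+k) _ ih) x hx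
    have : 0 < 1 - x := by linarith [hx.2]
    unfold Phi
    positivity

/-- pointwise rewriting of the integrand -/
lemma Mom_G (t q : ℝ) (m j : ℕ) (φ : ℝ → ℝ) (h0 : ∀ x ∈ Ioo (0:ℝ) 1, 0 ≤ φ x) :
    Mom (m + j) (q + 1) (Gt t m φ) = ∫⁻ r in Ioo (0:ℝ) 1,
      ENNReal.ofReal (Ft t m φ r) * ENNReal.ofReal (r ^ j * (1 - r) ^ (q - t)) := by
  refine setLIntegral_congr_fun measurableSet_Ioo fun r hr => ?_
  have h1 : 0 < 1 - r := by linarith [hr.2]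
  have hr0 := hr.1
  rw [← ENNReal.ofReal_mul (Ft_nonneg t m φ h0 r hr.1.le)]
  congr 1
  unfold Gt
  have e : (1 - r) ^ (q + 1) = (1 - r) ^ (q - t) * (1 - r) ^ (t + 1) := by
    rw [← Real.rpow_add h1]; congr 1; ring
  have h2 : 0 < (1 - r) ^ (t + 1) := Real.rpow_pos_of_pos h1 _
  rw [e, pow_add]
  field_simp

lemma Mom_upper (t q : ℝ) (hq : q ≤ t) (m j : ℕ) (hm : 1 ≤ m) (φ : ℝ → ℝ) (hφ : Measurable φ)
    (h0 : ∀ x ∈ Ioo (0:ℝ) 1, 0 ≤ φ x) :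
    Mom (m + j) (q + 1) (Gt t m φ) ≤ Mom (m + j) q φ := by
  rw [Mom_G t q m j φ h0]
  have hf : Measurable (fun r : ℝ => ENNReal.ofReal (r ^ (m - 1) * φ r * (1 - r) ^ t)) := by
    fun_prop
  have hg : Measurable (fun r : ℝ => ENNReal.ofReal (r ^ j * (1 - r) ^ (q - t))) := by
    fun_prop
  calc _ ≤ ∫⁻ r in Ioo (0:ℝ) 1, (∫⁻ x in Ioo r 1, ENNReal.ofReal (x ^ (m - 1) * φ x * (1 - x) ^ t))
        * ENNReal.ofReal (r ^ j * (1 - r) ^ (q - t)) := by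
        refine setLIntegral_mono' measurableSet_Ioo fun r hr => ?_
        gcongr
        unfold Ft
        rw [integral_eq_lintegral_of_nonneg_ae]
        · exact ENNReal.ofReal_toReal_le
        · refine (ae_restrict_iff' measurableSet_Ioo).2 (Filter.Eventually.of_forall fun x hx => ?_)
          have hx0 : 0 < x := hr.1.trans hx.1
          have := h0 x ⟨hx0, hx.2⟩
          have : 0 < 1 - x := by linarith [hx.2]
          simp only [Pi.zero_apply]
          positivity
        · exact Measurable.aestronglyMeasurable (by fun_prop)
    _ = _ := tri_swap _ _ hf hg
    _ ≤ Mom (m + j) q φ := by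
        refine setLIntegral_mono' measurableSet_Ioo fun x hx => ?_
        have h1 : 0 < 1 - x := by linarith [hx.2]
        have hx0 := hx.1
        have hφx := h0 x hx
        calc _ ≤ ENNReal.ofReal (x ^ (m - 1) * φ x * (1 - x) ^ t) *
              ∫⁻ r in Ioo (0:ℝ) x, ENNReal.ofReal (x ^ j * (1 - x) ^ (q - t)) := by
              refine mul_le_mul' le_rfl ?_
              refine setLIntegral_mono' measurableSet_Ioo fun r hr => ?_
              apply ENNReal.ofReal_le_ofReal
              have h3 : 0 < 1 - r := by linarith [hr.2]
              refine mul_le_mul (pow_le_pow_left₀ hr.1.le hr.2.le _) ?_ (by positivity) (by positivity)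
              exact Real.rpow_le_rpow_of_nonpos h1 (by linarith [hr.2]) (by linarith)
          _ = _ := by
              rw [setLIntegral_const, Real.volume_Ioo, sub_zero,
                ← ENNReal.ofReal_mul (by positivity), ← ENNReal.ofReal_mul (by positivity)]
              congr 1
              have e : (1 - x) ^ q = (1 - x) ^ (q - t) * (1 - x) ^ t := by
                rw [← Real.rpow_add h1]; congr 1; ring
              obtain ⟨m, rfl⟩ : ∃ a, m = a + 1 := ⟨m - 1, by omega⟩
              rw [e]
              simp only [Nat.add_sub_cancel]
              ring

lemma Mom_lower (t : ℝ) (m j : ℕ) (hm : 1 ≤ m) (φ : ℝ → ℝ) (hφ : Measurable φ)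
    (h0 : ∀ x ∈ Ioo (0:ℝ) 1, 0 ≤ φ x) (hfin : Mom m t φ < ⊤) :
    ENNReal.ofReal ((1/2) ^ (j + 1)) * Mom (m + j) t φ ≤ Mom (m + j) (t + 1) (Gt t m φ) := by
  rw [Mom_G t t m j φ h0]
  have hf : Measurable (fun r : ℝ => ENNReal.ofReal (r ^ (m - 1) * φ r * (1 - r) ^ t)) := by
    fun_prop
  have hg : Measurable (fun r : ℝ => ENNReal.ofReal (r ^ j * (1 - r) ^ (t - t))) := by
    fun_prop
  calc _ ≤ _ := ?_
    _ = _ := (tri_swap _ _ hf hg).symm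
    _ = _ := by
        refine setLIntegral_congr_fun measurableSet_Ioo fun r hr => ?_
        congr 1
        have hr0 := hr.1
        have hnn : ∀ x ∈ Ioo r 1, 0 ≤ x ^ (m - 1) * φ x * (1 - x) ^ t := by
          intro x hx
          have hx0 : 0 < x := hr.1.trans hx.1
          have := h0 x ⟨hx0, hx.2⟩
          have : 0 < 1 - x := by linarith [hx.2]
          positivity
        unfold Ft
        rw [integral_eq_lintegral_of_nonneg_ae, ENNReal.ofReal_toReal]
        · refine ne_of_lt (lt_of_le_of_lt (b := ENNReal.ofReal r⁻¹ * Mom m t φ) ?_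
            (ENNReal.mul_lt_top ENNReal.ofReal_lt_top hfin))
          unfold Mom
          rw [← lintegral_const_mul' _ _ ENNReal.ofReal_ne_top]
          refine le_trans (setLIntegral_mono' measurableSet_Ioo fun x hx => ?_)
            (lintegral_mono_set (Ioo_subset_Ioo_left hr.1.le))
          rw [← ENNReal.ofReal_mul (by positivity)]
          apply ENNReal.ofReal_le_ofReal
          have hx0 : 0 < x := hr.1.trans hx.1
          have := hnn x hx
          have h5 : 1 ≤ r⁻¹ * x := by
            rw [inv_mul_eq_div, le_div_iff₀ hr.1]; linarith [hx.1]
          obtain ⟨m, rfl⟩ : ∃ a, m = a + 1 := ⟨m - 1, by omega⟩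
          simp only [Nat.add_sub_cancel] at *
          calc _ = 1 * (x ^ m * φ x * (1 - x) ^ t) := by ring
            _ ≤ (r⁻¹ * x) * (x ^ m * φ x * (1 - x) ^ t) := by gcongr
            _ = _ := by ring
        · exact (ae_restrict_iff' measurableSet_Ioo).2 (Filter.Eventually.of_forall hnn)
        · exact Measurable.aestronglyMeasurable (by fun_prop)
  unfold Mom
  rw [← lintegral_const_mul' _ _ ENNReal.ofReal_ne_top]
  refine setLIntegral_mono' measurableSet_Ioo fun x hx => ?_
  have h1 : 0 < 1 - x := by linarith [hx.2]
  have hx0 := hx.1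
  have hφx := h0 x hx
  calc _ = ENNReal.ofReal (x ^ (m - 1) * φ x * (1 - x) ^ t) *
              ∫⁻ r in Ioo (x/2) x, ENNReal.ofReal ((x/2) ^ j) := by
              rw [setLIntegral_const, Real.volume_Ioo,
                ← ENNReal.ofReal_mul (by positivity), ← ENNReal.ofReal_mul (by positivity),
                ← ENNReal.ofReal_mul (by positivity)]
              congr 1
              obtain ⟨m, rfl⟩ : ∃ a, m = a + 1 := ⟨m - 1, by omega⟩
              simp only [Nat.add_sub_cancel, div_pow]
              field_simp
              ring
    _ ≤ _ := by
      refine mul_le_mul' le_rfl ?_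
      refine le_trans (setLIntegral_mono' measurableSet_Ioo fun r hr => ?_)
            (lintegral_mono_set (Ioo_subset_Ioo_left (by positivity)))
      apply ENNReal.ofReal_le_ofReal
      rw [sub_self, Real.rpow_zero, mul_one]
      exact pow_le_pow_left₀ (by positivity) hr.1.le _

lemma Mom_Phi_succ (t q : ℝ) (n k p : ℕ) :
    Mom p q (Phi t n (k+1)) = Mom p (q + 1) (Gt t (n+k) (Gt t (n+k) (Phi t n k))) := by
  refine setLIntegral_congr_fun measurableSet_Ioo fun x hx => ?_
  have h1 : 0 < 1 - x := by linarith [hx.2]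
  simp only [Phi]
  rw [Real.rpow_add h1, Real.rpow_one]
  congr 1; ring

lemma Mom_Phi_upper (t : ℝ) (n : ℕ) (hn : 1 ≤ n) (k : ℕ) : ∀ (q : ℝ) (_ : q ≤ t) (p : ℕ)
    (_ : n + k ≤ p + 1), Mom p q (Phi t n k) ≤ Mom p (q - k) (fun _ => 1) := by
  induction k with
  | zero => intro q hq p hp; simp [Phi]
  | succ k ih =>
    intro q hq p hp
    obtain ⟨j, rfl⟩ : ∃ j, p = n + k + j := ⟨p - (n+k), by omega⟩
    rw [Mom_Phi_succ]
    refine (Mom_upper t q hq (n+k) j (by omega) _ (Gt_meas _ _ _ (Phi_meas _ _ _))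
      (Gt_nonneg _ _ _ (Phi_nonneg _ _ _))).trans ?_
    have := (Mom_upper t (q-1) (by linarith) (n+k) j (by omega) _ (Phi_meas t n k)
      (Phi_nonneg t n k))
    rw [sub_add_cancel] at this
    refine this.trans ((ih (q-1) (by linarith) _ (by omega)).trans (le_of_eq ?_))
    congr 1
    push_cast; ring

lemma Mom_one_upper (p : ℕ) (q : ℝ) (hq : 0 < q) :
    Mom p q (fun _ => 1) ≤ ENNReal.ofReal (Nat.factorial p / q ^ (p + 1)) := by
  have hI := Real.integral_rpow_mul_exp_neg_mul_Ioi (a := (p:ℝ) + 1) (by positivity) hq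
  have hint : IntegrableOn (fun x : ℝ => x ^ ((p:ℝ) + 1 - 1) * Real.exp (-(q * x))) (Ioi 0) := by
    by_contra h
    rw [integral_undef h] at hI
    have : 0 < (1 / q) ^ ((p:ℝ) + 1) * Real.Gamma ((p:ℝ) + 1) :=
      mul_pos (by positivity) (Real.Gamma_pos_of_pos (by positivity))
    linarith
  have hv : (Nat.factorial p / q ^ (p + 1) : ℝ) =
      ∫ x in Ioi (0:ℝ), x ^ ((p:ℝ) + 1 - 1) * Real.exp (-(q * x)) := by
    rw [hI, Real.Gamma_nat_eq_factorial]
    have : ((p:ℝ) + 1) = ((p + 1 : ℕ) : ℝ) := by push_cast; ring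
    rw [this, Real.rpow_natCast, one_div, inv_pow]
    field_simp
  rw [hv, ofReal_integral_eq_lintegral_ofReal hint]
  · refine le_trans (setLIntegral_mono' measurableSet_Ioo fun x hx => ?_)
      (lintegral_mono_set Ioo_subset_Ioi_self)
    apply ENNReal.ofReal_le_ofReal
    have h1 : 0 < 1 - x := by linarith [hx.2]
    have hx0 := hx.1
    rw [add_sub_cancel_right, Real.rpow_natCast, mul_one]
    gcongr
    calc (1 - x) ^ q ≤ (Real.exp (-x)) ^ q :=
          Real.rpow_le_rpow h1.le (by linarith [Real.add_one_le_exp (-x)]) hq.le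
      _ = _ := by rw [← Real.exp_mul]; congr 1; ring
  · refine (ae_restrict_iff' measurableSet_Ioi).2 (Filter.Eventually.of_forall fun x hx => ?_)
    have : 0 < x := hx
    simp only [Pi.zero_apply]
    positivity

lemma Mom_one_lower (p : ℕ) (t : ℝ) (ht : 1 ≤ t) :
    ENNReal.ofReal ((1/4) ^ (p + 1) / 2 / t ^ (p + 1)) ≤ Mom p t (fun _ => 1) := by
  have ht0 : 0 < t := by linarith
  calc _ = ∫⁻ x in Ioo (1/(4*t)) (1/(2*t)), ENNReal.ofReal ((1/(4*t)) ^ p * (1/2)) := by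
        rw [setLIntegral_const, Real.volume_Ioo, ← ENNReal.ofReal_mul (by positivity)]
        congr 1
        simp only [div_pow, mul_pow]
        field_simp
        ring
    _ ≤ _ := by
      have h2 : 1/(2*t) ≤ 1 / 2 := by
        apply one_div_le_one_div_of_le <;> linarith
      refine le_trans (setLIntegral_mono' measurableSet_Ioo fun x hx => ?_)
        (lintegral_mono_set (Ioo_subset_Ioo (by positivity) (by linarith)))
      apply ENNReal.ofReal_le_ofReal
      have hx0 : 0 < x := lt_trans (by positivity) hx.1
      rw [mul_one]
      refine mul_le_mul (pow_le_pow_left₀ (by positivity) hx.1.le _) ?_ (by positivity) (by positivity)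
      have hb := one_add_mul_self_le_rpow_one_add (s := -x) (by linarith [hx.2]) ht
      have h3 : t * x ≤ 1/2 := by
        have := hx.2
        rw [lt_div_iff₀ (by positivity)] at this
        linarith
      rw [← sub_eq_add_neg] at hb
      linarith

lemma Mom_mono_q (p : ℕ) {q q' : ℝ} (h : q ≤ q') (φ : ℝ → ℝ)
    (h0 : ∀ x ∈ Ioo (0:ℝ) 1, 0 ≤ φ x) : Mom p q' φ ≤ Mom p q φ := by
  refine setLIntegral_mono' measurableSet_Ioo fun x hx => ?_
  apply ENNReal.ofReal_le_ofReal
  have h1 : 0 < 1 - x := by linarith [hx.2]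
  have hx0 := hx.1
  have := h0 x hx
  have := Real.rpow_le_rpow_of_exponent_ge h1 (by linarith) h
  gcongr

lemma Mom_Phi_fin (t : ℝ) (n k p : ℕ) (hn : 1 ≤ n) (q : ℝ) (hq : q ≤ t) (hk : k < q)
    (hp : n + k ≤ p + 1) : Mom p q (Phi t n k) < ⊤ :=
  ((Mom_Phi_upper t n hn k q hq p hp).trans
    (Mom_one_upper p (q - k) (by linarith))).trans_lt ENNReal.ofReal_lt_top

lemma Mom_Phi_lower (n : ℕ) (hn : 1 ≤ n) (k p : ℕ) (hp : n + k ≤ p + 1) : ∃ c : ℝ, 0 < c ∧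
    ∀ t : ℝ, (k:ℝ) + 1 < t → ENNReal.ofReal c * Mom p t (fun _ => 1) ≤ Mom p t (Phi t n k) := by
  induction k with
  | zero => exact ⟨1, one_pos, fun t _ => by simp [Phi]⟩
  | succ k ih =>
    obtain ⟨c, hc, h⟩ := ih (by omega)
    obtain ⟨j, rfl⟩ : ∃ j, p = n + k + j := ⟨p - (n+k), by omega⟩
    refine ⟨(1/2)^(j+1) * ((1/2)^(j+1) * c), by positivity, fun t ht => ?_⟩
    push_cast at ht
    have hP := Phi_meas t n k
    have hP0 := Phi_nonneg t n k
    have hG0 := Gt_nonneg t (n+k) _ hP0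
    have f1 : Mom (n+k) t (Phi t n k) < ⊤ := Mom_Phi_fin t n k (n+k) hn t le_rfl (by linarith) (by omega)
    have f2 : Mom (n+k) t (Gt t (n+k) (Phi t n k)) < ⊤ := by
      have := Mom_upper t (t-1) (by linarith) (n+k) 0 (by omega) _ hP hP0
      rw [sub_add_cancel] at this
      exact this.trans_lt (Mom_Phi_fin t n k (n+k) hn (t-1) (by linarith) (by linarith) (by omega))
    rw [Mom_Phi_succ]
    refine le_trans ?_ (Mom_lower t (n+k) j (by omega) _ (Gt_meas t (n+k) _ hP) hG0 f2)
    rw [ENNReal.ofReal_mul (by positivity), ENNReal.ofReal_mul (by positivity), mul_assoc, mul_assoc]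
    gcongr
    refine le_trans ?_ (Mom_mono_q _ (by linarith : t ≤ t + 1) _ hG0)
    refine le_trans ?_ (Mom_lower t (n+k) j (by omega) _ hP hP0 f1)
    gcongr
    exact h t (by linarith)

lemma integral_eq_Mom (p : ℕ) (q : ℝ) (φ : ℝ → ℝ) (hφ : Measurable φ)
    (h0 : ∀ x ∈ Ioo (0:ℝ) 1, 0 ≤ φ x) :
    ∫ x in Ioo (0:ℝ) 1, x ^ p * (1 - x) ^ q * φ x = (Mom p q φ).toReal := by
  rw [integral_eq_lintegral_of_nonneg_ae]
  · rfl
  · refine (ae_restrict_iff' measurableSet_Ioo).2 (Filter.Eventually.of_forall fun x hx => ?_)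
    have hx0 : 0 < x := hx.1
    have := h0 x hx
    have : 0 < 1 - x := by linarith [hx.2]
    simp only [Pi.zero_apply]
    positivity
  · exact Measurable.aestronglyMeasurable (by fun_prop)

/-- Two-sided estimate `𝓕^{(t)}_{n+k}Φ^{(t)}_{n,k}(0) ≈ t^{−n−k}` for large `t`, and
the bound `∫_0^1 Φ^{(t)}_{n,k}(s) s^{n+k−1}(1−s)^{t/4} ds ≤ C t^{−n−k}`. -/
theorem stmt10 (n k : ℕ) (hn : 1 ≤ n) :
    ∃ C c t₀ : ℝ, 0 < c ∧ c < C ∧ 0 < t₀ ∧ ∀ t : ℝ, t₀ < t →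
      c * t ^ (-(n : ℝ) - k) ≤ Ft t (n + k) (Phi t n k) 0 ∧
      Ft t (n + k) (Phi t n k) 0 ≤ C * t ^ (-(n : ℝ) - k) ∧
      (∫ s in Set.Ioo (0 : ℝ) 1, Phi t n k s * s ^ (n + k - 1) * (1 - s) ^ (t / 4))
        ≤ C * t ^ (-(n : ℝ) - k) := by
  obtain ⟨p, hp⟩ : ∃ p, n + k = p + 1 := ⟨n + k - 1, by omega⟩
  obtain ⟨c, hc, hlow⟩ := Mom_Phi_lower n hn k p hp.le
  set c' : ℝ := c * ((1/4) ^ (p + 1) / 2) with hc'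
  have hc'0 : 0 < c' := by positivity
  set C' : ℝ := Nat.factorial p * 8 ^ (p + 1) with hC'
  have hC'0 : 0 < C' := by positivity
  refine ⟨C' + c', c', 8 * (k + 1), hc'0, by linarith, by positivity, fun t ht => ?_⟩
  have hk0 : (0:ℝ) ≤ k := Nat.cast_nonneg k
  have ht0 : 0 < t := by nlinarith
  have hpow : t ^ (-(n:ℝ) - k) = 1 / t ^ (p + 1) := by
    have : -(n:ℝ) - k = -((p + 1 : ℕ) : ℝ) := by rw [← hp]; push_cast; ring
    rw [this, Real.rpow_neg ht0.le, Real.rpow_natCast, one_div]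
  have hP := Phi_meas t n k
  have hP0 := Phi_nonneg t n k
  have e1 : Ft t (n + k) (Phi t n k) 0 = (Mom p t (Phi t n k)).toReal := by
    rw [← integral_eq_Mom p t _ hP hP0, hp]
    unfold Ft
    congr 1; ext x
    simp only [Nat.add_sub_cancel]; ring
  have e2 : (∫ s in Set.Ioo (0 : ℝ) 1, Phi t n k s * s ^ (n + k - 1) * (1 - s) ^ (t / 4))
      = (Mom p (t/4) (Phi t n k)).toReal := by
    rw [← integral_eq_Mom p (t/4) _ hP hP0, hp]
    congr 1; ext x
    simp only [Nat.add_sub_cancel]; ring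
  have u2 : Mom p (t/4) (Phi t n k) ≤ ENNReal.ofReal (C' / t ^ (p + 1)) := by
    refine (Mom_Phi_upper t n hn k (t/4) (by linarith) p hp.le).trans
      ((Mom_one_upper p _ (by linarith)).trans (ENNReal.ofReal_le_ofReal ?_))
    have : (t / 8) ^ (p + 1) ≤ (t / 4 - k) ^ (p + 1) :=
      pow_le_pow_left₀ (by positivity) (by linarith) _
    calc (Nat.factorial p : ℝ) / (t / 4 - k) ^ (p + 1) ≤ Nat.factorial p / (t / 8) ^ (p + 1) := by
          gcongr
      _ = _ := by rw [hC', div_pow]; field_simp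
  have u1 : Mom p t (Phi t n k) ≤ ENNReal.ofReal (C' / t ^ (p + 1)) :=
    (Mom_mono_q p (by linarith) _ hP0).trans u2
  have l1 : ENNReal.ofReal (c' / t ^ (p + 1)) ≤ Mom p t (Phi t n k) := by
    refine le_trans ?_ (hlow t (by linarith))
    have : c' / t ^ (p + 1) = c * ((1/4) ^ (p + 1) / 2 / t ^ (p + 1)) := by rw [hc']; ring
    rw [this, ENNReal.ofReal_mul hc.le]
    gcongr
    exact Mom_one_lower p t (by linarith)
  have hle : C' / t ^ (p + 1) ≤ (C' + c') * (1 / t ^ (p + 1)) := by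
    rw [mul_one_div]; gcongr; linarith
  rw [e1, e2, hpow]
  refine ⟨?_, ?_, ?_⟩
  · rw [mul_one_div]
    exact (ENNReal.ofReal_le_iff_le_toReal (u1.trans_lt ENNReal.ofReal_lt_top).ne).1 l1
  · exact (ENNReal.toReal_le_of_le_ofReal (by positivity) u1).trans hle
  · exact (ENNReal.toReal_le_of_le_ofReal (by positivity) u2).trans hle
end

section
/- Let n ≥ 1, r > 0, and let α, β ∈ ℕ₀ⁿ be multi-indices with |α| ≥ |β|. For every function v of class C¹ on a neighborhood of the closed ball {z ∈ ℂⁿ : |z| ≤ r}, ∫_{r𝕊ₙ} z^α·conj(z)^β·v(z) dσ_r(z) = a_{α,β}·σ_{2n−1}·r^{2|β|+2n−1}·v(0) + 2·r^{2|β|+2n−1}·∫_{r𝔹ₙ} (z^α·conj(z)^β / |z|^{2|β|+2n})·(R̄v)(z) dm(z), where a_{α,β} = (n−1)!·α!/(n−1+|β|)! if α ≤ β componentwise, and a_{α,β} = 0 otherwise. -/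
open MeasureTheory
open scoped Classical

noncomputable instance {n : ℕ} : InnerProductSpace ℝ (EuclideanSpace ℂ (Fin n)) :=
  InnerProductSpace.complexToReal

noncomputable instance {n : ℕ} : MeasurableSpace (EuclideanSpace ℂ (Fin n)) := borel _

instance {n : ℕ} : BorelSpace (EuclideanSpace ℂ (Fin n)) := ⟨rfl⟩

/-- The surface measure `σ_r` on the sphere of radius `r` in `ℂⁿ`, pushed forward to
the ambient space: the image under `x ↦ r • x` of the surface measure
`volume.toSphere` on the unit sphere, scaled by `r^{2n−1}`. -/
noncomputable def sphereMeas (n : ℕ) (r : ℝ) : Measure (EuclideanSpace ℂ (Fin n)) :=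
  ENNReal.ofReal (r ^ (2 * n - 1)) •
    Measure.map (fun x : Metric.sphere (0 : EuclideanSpace ℂ (Fin n)) 1 =>
        r • (x : EuclideanSpace ℂ (Fin n)))
      (volume : Measure (EuclideanSpace ℂ (Fin n))).toSphere

/-- The `j`-th Wirtinger derivative `∂̄_j v(z) = ½(∂v/∂x_j + i ∂v/∂y_j)`. -/
noncomputable def wdbar {n : ℕ} (v : EuclideanSpace ℂ (Fin n) → ℂ) (j : Fin n)
    (z : EuclideanSpace ℂ (Fin n)) : ℂ :=
  (1 / 2 : ℂ) * (fderiv ℝ v z (EuclideanSpace.single j 1) +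
    Complex.I * fderiv ℝ v z (EuclideanSpace.single j Complex.I))

/-- `R̄v(z) = ∑_j conj(z_j) ∂̄_j v(z)`. -/
noncomputable def Rbar {n : ℕ} (v : EuclideanSpace ℂ (Fin n) → ℂ)
    (z : EuclideanSpace ℂ (Fin n)) : ℂ :=
  ∑ j, (starRingEnd ℂ) (z j) * wdbar v j z

/-- The constant `a_{α,β}`: `(n−1)! α!/(n−1+|β|)!` if `α ≤ β`, and `0` otherwise. -/
noncomputable def aCoef (n : ℕ) (α β : Fin n → ℕ) : ℝ :=
  if α ≤ β then
    ((Nat.factorial (n - 1) : ℝ) * ∏ j, (Nat.factorial (α j) : ℝ)) /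
      (Nat.factorial (n - 1 + ∑ i, β i) : ℝ)
  else 0

/-- The total surface measure `σ_{2n−1} = 2πⁿ/(n−1)!` of the unit sphere. -/
noncomputable def sigmaTot (n : ℕ) : ℝ := 2 * Real.pi ^ n / (Nat.factorial (n - 1) : ℝ)


section polarSec
open Measure Set Metric
variable {E : Type*} [NormedAddCommGroup E] [NormedSpace ℝ E] [MeasurableSpace E] [BorelSpace E]
  [FiniteDimensional ℝ E] [Nontrivial E] (μ : Measure E) [μ.IsAddHaarMeasure]
  {F : Type*} [NormedAddCommGroup F] [NormedSpace ℝ F]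

lemma aux_polar (f : E → F) :
    ∫ x, f x ∂μ = ∫ p : sphere (0 : E) 1 × ℝ, p.2 ^ (Module.finrank ℝ E - 1) • f (p.2 • (p.1 : E))
      ∂(μ.toSphere.prod (volume.restrict (Ioi 0))) := by
  set d := Module.finrank ℝ E - 1
  have h1 : ∫ x, f x ∂μ = ∫ x : ({(0)}ᶜ : Set E), f x ∂(μ.comap (↑)) := by
    rw [integral_subtype_comap (measurableSet_singleton _).compl f, restrict_compl_singleton]
  have h2 : ∫ x : ({(0)}ᶜ : Set E), f x ∂(μ.comap (↑))
      = ∫ p, f (p.2.1 • (p.1 : E)) ∂(μ.toSphere.prod (volumeIoiPow d)) := by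
    rw [← μ.measurePreserving_homeomorphUnitSphereProd.integral_comp
        (Homeomorph.measurableEmbedding _) (fun p => f (p.2.1 • (p.1 : E)))]
    refine integral_congr_ae (.of_forall fun x => ?_)
    have hx : ‖(x : E)‖ ≠ 0 := norm_ne_zero_iff.2 x.2
    simp [smul_smul, hx]
  have hs : SFinite (Measure.comap (Subtype.val : Ioi (0:ℝ) → ℝ) volume) := by
    have h0 : SigmaFinite (volumeIoiPow 0) := inferInstance
    have h00 : volumeIoiPow 0 = Measure.comap (Subtype.val : Ioi (0:ℝ) → ℝ) volume := by
      simp only [volumeIoiPow, pow_zero, ENNReal.ofReal_one]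
      exact withDensity_one
    rw [h00] at h0
    infer_instance
  rw [h1, h2, volumeIoiPow, prod_withDensity_right, integral_withDensity_eq_integral_toReal_smul]
  · have hmp : MeasurePreserving (Subtype.val : Ioi (0:ℝ) → ℝ) (volume.comap Subtype.val)
        (volume.restrict (Ioi 0)) :=
      ⟨measurable_subtype_coe, map_comap_subtype_coe measurableSet_Ioi _⟩
    have hmp2 := (MeasurePreserving.id μ.toSphere).prod hmp
    have he : MeasurableEmbedding (Prod.map (id : sphere (0:E) 1 → _) (Subtype.val : Ioi (0:ℝ) → ℝ)) :=
      MeasurableEmbedding.prodMap MeasurableEmbedding.id (MeasurableEmbedding.subtype_coe measurableSet_Ioi)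
    rw [← hmp2.integral_comp he]
    refine integral_congr_ae (.of_forall fun p => ?_)
    have : 0 ≤ p.2.1 ^ d := pow_nonneg p.2.2.out.le _
    simp [ENNReal.toReal_ofReal this]
  · fun_prop
  · simp
  · fun_prop

lemma aux_polar_mul (f : E → ℂ) (h : ℝ → ℂ) (g : sphere (0 : E) 1 → ℂ)
    (hf : ∀ z : sphere (0 : E) 1, ∀ ρ : ℝ, 0 < ρ → f (ρ • (z : E)) = g z * h ρ) :
    ∫ x, f x ∂μ = (∫ z, g z ∂μ.toSphere) *
      ∫ ρ in Ioi (0:ℝ), ρ ^ (Module.finrank ℝ E - 1) * h ρ := by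
  rw [aux_polar, ← integral_prod_mul]
  refine integral_congr_ae ?_
  have : ∀ᵐ p : sphere (0 : E) 1 × ℝ ∂(μ.toSphere.prod (volume.restrict (Ioi 0))), 0 < p.2 := by
    have := ae_restrict_mem (μ := (volume : Measure ℝ)) (measurableSet_Ioi (a := (0:ℝ)))
    exact (quasiMeasurePreserving_snd).ae this
  filter_upwards [this] with p hp
  rw [hf _ _ hp]
  simp
  ring

lemma aux_gauss_int (m : ℕ) :
    ∫ ρ in Ioi (0:ℝ), (ρ:ℂ) ^ (2 * m + 1) * (Real.exp (-ρ^2) : ℂ) = (m.factorial : ℂ) / 2 := by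
  have h := integral_rpow_mul_exp_neg_rpow (p := 2) (q := 2*m+1) (by norm_num)
    (by have : (0:ℝ) ≤ m := Nat.cast_nonneg m
        linarith)
  have h2 : ∫ ρ in Ioi (0:ℝ), ρ ^ (2 * m + 1) * Real.exp (-ρ^2) = (m.factorial : ℝ) / 2 := by
    rw [← Real.Gamma_nat_eq_factorial]
    have : ((2 * (m:ℝ) + 1 + 1) / 2) = m + 1 := by ring
    rw [this] at h
    rw [div_eq_inv_mul, ← one_div, ← h]
    refine setIntegral_congr_fun measurableSet_Ioi fun x hx => ?_
    norm_cast
  calc _ = ((∫ ρ in Ioi (0:ℝ), ρ ^ (2 * m + 1) * Real.exp (-ρ^2) : ℝ) : ℂ) := by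
        rw [← integral_complex_ofReal]
        push_cast
        rfl
    _ = _ := by rw [h2]; push_cast; rfl

lemma aux_sphere_inv (A : E ≃ₗᵢ[ℝ] E) (hA : MeasurePreserving A μ μ) 
    (hd : ∃ m, Module.finrank ℝ E = 2 * (m + 1)) (f : E → ℂ) :
    ∫ z : sphere (0 : E) 1, f (A z) ∂μ.toSphere = ∫ z : sphere (0 : E) 1, f z ∂μ.toSphere := by
  obtain ⟨m, hm⟩ := hd
  have h1 := aux_polar_mul μ (fun x => f (‖x‖⁻¹ • x) * (Real.exp (-‖x‖^2) : ℂ))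
    (fun ρ => (Real.exp (-ρ^2) : ℂ)) (fun z => f z) (by
      intro z ρ hρ
      simp [norm_smul, abs_of_pos hρ, smul_smul, hρ.ne'])
  have h2 := aux_polar_mul μ (fun x => f (‖x‖⁻¹ • A x) * (Real.exp (-‖x‖^2) : ℂ))
    (fun ρ => (Real.exp (-ρ^2) : ℂ)) (fun z => f (A z)) (by
      intro z ρ hρ
      simp [norm_smul, abs_of_pos hρ, smul_smul, hρ.ne'])
  have h3 : ∫ x, f (‖x‖⁻¹ • x) * (Real.exp (-‖x‖^2) : ℂ) ∂μ 
      = ∫ x, f (‖x‖⁻¹ • A x) * (Real.exp (-‖x‖^2) : ℂ) ∂μ := by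
    rw [← hA.integral_comp A.toHomeomorph.measurableEmbedding]
    simp
  have hd : Module.finrank ℝ E - 1 = 2 * m + 1 := by omega
  rw [h1, h2, hd, aux_gauss_int] at h3
  have : (m.factorial : ℂ) / 2 ≠ 0 := by simp [Nat.factorial_ne_zero]
  exact (mul_right_cancel₀ this h3).symm

end polarSec

section gaussSec
open Set Metric

lemma aux_gauss_C (a b : ℕ) :
    ∫ z : ℂ, z ^ a * (starRingEnd ℂ) z ^ b * (Real.exp (-‖z‖^2) : ℂ)
      = if a = b then (Real.pi : ℂ) * (a.factorial : ℂ) else 0 := by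
  split_ifs with hab
  · subst hab
    have h := Complex.integral_rpow_mul_exp_neg_rpow (p := 2) (q := 2*a) (by norm_num)
      (by have : (0:ℝ) ≤ a := Nat.cast_nonneg a
          linarith)
    have h3 : ((2 * (a:ℝ) + 2) / 2) = a + 1 := by ring
    rw [h3, Real.Gamma_nat_eq_factorial] at h
    have h2 : ∫ x : ℂ, ‖x‖ ^ (2 * a) * Real.exp (-‖x‖^2) = Real.pi * (a.factorial : ℝ) := by
      have : (2 * Real.pi / 2) = Real.pi := by ring
      rw [this] at h
      rw [← h]
      congr 1
      ext x
      norm_cast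
    calc _ = ((∫ x : ℂ, ‖x‖ ^ (2 * a) * Real.exp (-‖x‖^2) : ℝ) : ℂ) := by
          rw [← integral_complex_ofReal]
          congr 1
          ext x
          rw [← mul_pow, Complex.mul_conj, Complex.normSq_eq_norm_sq]
          push_cast
          rw [← pow_mul]
      _ = _ := by rw [h2]; push_cast; rfl
  · have hab' : ((a:ℝ) - b) ≠ 0 := sub_ne_zero.2 (by exact_mod_cast hab)
    set w : Circle := Circle.exp (Real.pi / (a - b)) with hw
    have hww : (w : ℂ) ^ a * (starRingEnd ℂ) (w:ℂ) ^ b = -1 := by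
      rw [← Complex.exp_pi_mul_I, hw, Circle.coe_exp, ← Complex.exp_conj, ← Complex.exp_nat_mul,
        ← Complex.exp_nat_mul, ← Complex.exp_add]
      congr 1
      have : ((a:ℂ) - b) ≠ 0 := by exact_mod_cast hab'
      simp
      field_simp
      ring
    have hmp := (rotation w).measurePreserving
    have h := hmp.integral_comp (rotation w).toHomeomorph.measurableEmbedding 
      (fun z : ℂ => z ^ a * (starRingEnd ℂ) z ^ b * (Real.exp (-‖z‖^2) : ℂ))
    have h2 : ∀ z : ℂ, (rotation w z) ^ a * (starRingEnd ℂ) (rotation w z) ^ b * 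
        (Real.exp (-‖rotation w z‖^2) : ℂ) = 
        - (z ^ a * (starRingEnd ℂ) z ^ b * (Real.exp (-‖z‖^2) : ℂ)) := by
      intro z
      rw [LinearIsometryEquiv.norm_map, rotation_apply, map_mul, mul_pow, mul_pow]
      linear_combination (z ^ a * (starRingEnd ℂ) z ^ b * (Real.exp (-‖z‖^2) : ℂ)) * hww
    simp_rw [h2] at h
    rw [integral_neg] at h
    exact self_eq_neg.1 h.symm

variable {n : ℕ}

lemma aux_finrank : Module.finrank ℝ (EuclideanSpace ℂ (Fin n)) = 2 * n := by
  rw [finrank_real_of_complex]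
  simp

lemma aux_vol_gauss : 
    ∫ z : EuclideanSpace ℂ (Fin n), (Real.exp (-‖z‖^2) : ℂ) = (Real.pi : ℂ) ^ n := by
  have h := GaussianFourier.integral_rexp_neg_mul_sq_norm (V := EuclideanSpace ℂ (Fin n)) (b := 1) (by norm_num)
  have hf : Module.finrank ℝ (EuclideanSpace ℂ (Fin n)) = 2 * n := aux_finrank
  rw [hf] at h
  rw [integral_complex_ofReal]
  have h2 : ((2 * n : ℕ) / 2 : ℝ) = n := by push_cast; ring
  rw [h2, Real.rpow_natCast] at h
  simp only [neg_mul, one_mul, div_one] at h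
  rw [h]
  push_cast
  rfl

lemma aux_norm_exp (z : EuclideanSpace ℂ (Fin n)) : 
    (Real.exp (-‖z‖^2) : ℂ) = ∏ j, (Real.exp (-‖z j‖^2) : ℂ) := by
  rw [EuclideanSpace.norm_sq_eq, ← Finset.sum_neg_distrib, Real.exp_sum]
  push_cast
  rfl

lemma aux_vol_eq : (volume : Measure (EuclideanSpace ℂ (Fin n))) = 
    (volume : Measure (Fin n → ℂ)).map (PiLp.continuousLinearEquiv 2 ℝ (fun _ : Fin n => ℂ)).symm := by
  set A := (PiLp.continuousLinearEquiv 2 ℝ (fun _ : Fin n => ℂ)).symm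
  have hAe : MeasurableEmbedding A := A.toHomeomorph.measurableEmbedding
  have hH : ((volume : Measure (Fin n → ℂ)).map A).IsAddHaarMeasure := A.isAddHaarMeasure_map _
  have h := Measure.isAddLeftInvariant_eq_smul ((volume : Measure (Fin n → ℂ)).map A) (volume : Measure (EuclideanSpace ℂ (Fin n)))
  obtain ⟨c, hc⟩ : ∃ c : NNReal, (volume : Measure (Fin n → ℂ)).map A = c • (volume : Measure (EuclideanSpace ℂ (Fin n))) := ⟨_, h⟩
  have h1 : ∫ z, (Real.exp (-‖z‖^2) : ℂ) ∂((volume : Measure (Fin n → ℂ)).map A) = (Real.pi : ℂ) ^ n := by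
    rw [hAe.integral_map]
    simp_rw [aux_norm_exp]
    have := integral_fintype_prod_volume_eq_prod (fun (_ : Fin n) (z : ℂ) => (Real.exp (-‖z‖^2) : ℂ))
    have h3 := aux_gauss_C 0 0
    simp at h3
    simp [A] at this ⊢
    rw [this, h3]
  rw [hc] at h1
  rw [integral_smul_nnreal_measure, aux_vol_gauss] at h1
  have hpi : (Real.pi : ℂ) ^ n ≠ 0 := pow_ne_zero _ (by exact_mod_cast Real.pi_ne_zero)
  have hc1 : c = 1 := by
    rw [NNReal.smul_def, Complex.real_smul] at h1
    have := mul_right_cancel₀ hpi (h1.trans (one_mul _).symm)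
    exact_mod_cast this
  rw [hc, hc1, one_smul]

lemma aux_gauss_moment (α β : Fin n → ℕ) : 
    ∫ z : EuclideanSpace ℂ (Fin n), (∏ j, z j ^ α j) * (∏ j, (starRingEnd ℂ) (z j) ^ β j) * 
      (Real.exp (-‖z‖^2) : ℂ) = if α = β then (Real.pi : ℂ) ^ n * ∏ j, ((α j).factorial : ℂ) else 0 := by
  have hAe : MeasurableEmbedding (PiLp.continuousLinearEquiv 2 ℝ (fun _ : Fin n => ℂ)).symm :=
    (PiLp.continuousLinearEquiv 2 ℝ (fun _ : Fin n => ℂ)).symm.toHomeomorph.measurableEmbedding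
  rw [aux_vol_eq, hAe.integral_map]
  simp_rw [aux_norm_exp]
  have := integral_fintype_prod_volume_eq_prod 
    (fun (j : Fin n) (z : ℂ) => z ^ α j * (starRingEnd ℂ) z ^ β j * (Real.exp (-‖z‖^2) : ℂ))
  simp_rw [aux_gauss_C] at this
  simp_rw [Finset.prod_mul_distrib] at this
  have h2 : (∏ x, if α x = β x then (Real.pi : ℂ) * ((α x).factorial : ℂ) else 0)
      = if α = β then (Real.pi : ℂ) ^ n * ∏ j, ((α j).factorial : ℂ) else 0 := by
    split_ifs with h
    · subst h
      simp [Finset.prod_mul_distrib]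
    · obtain ⟨j, hj⟩ := Function.ne_iff.1 h
      exact Finset.prod_eq_zero (Finset.mem_univ j) (by simp [hj])
  rw [← h2, ← this]
  rfl

end gaussSec

section momSec
open Set Metric
variable {n : ℕ}

noncomputable def auxP (α β : Fin n → ℕ) (z : EuclideanSpace ℂ (Fin n)) : ℂ :=
  (∏ j, z j ^ α j) * (∏ j, (starRingEnd ℂ) (z j) ^ β j)

lemma auxP_smul (α β : Fin n → ℕ) (c : ℂ) (z : EuclideanSpace ℂ (Fin n)) :
    auxP α β (c • z) = c ^ (∑ i, α i) * (starRingEnd ℂ) c ^ (∑ i, β i) * auxP α β z := by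
  simp only [auxP, PiLp.smul_apply, smul_eq_mul, map_mul, mul_pow, Finset.prod_mul_distrib,
    Finset.prod_pow_eq_pow_sum]
  ring

lemma auxP_rsmul (α β : Fin n → ℕ) (c : ℝ) (z : EuclideanSpace ℂ (Fin n)) :
    auxP α β (c • z) = (c:ℂ) ^ (∑ i, α i + ∑ i, β i) * auxP α β z := by
  have : c • z = (c : ℂ) • z := by
    ext j; simp
  rw [this, auxP_smul, Complex.conj_ofReal, pow_add]

lemma auxP_cont (α β : Fin n → ℕ) : Continuous (auxP α β) := by
  unfold auxP
  fun_prop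

lemma aux_nontriv (hn : 1 ≤ n) : Nontrivial (EuclideanSpace ℂ (Fin n)) := by
  have : Nonempty (Fin n) := ⟨⟨0, hn⟩⟩
  infer_instance

lemma aux_sphere_moment (hn : 1 ≤ n) (α β : Fin n → ℕ) (hαβ : (∑ i, β i) = ∑ i, α i) :
    ∫ z : sphere (0 : EuclideanSpace ℂ (Fin n)) 1, auxP α β z
      ∂(volume : Measure (EuclideanSpace ℂ (Fin n))).toSphere
      = ((aCoef n α β * sigmaTot n : ℝ) : ℂ) := by
  have := aux_nontriv hn
  have hf : Module.finrank ℝ (EuclideanSpace ℂ (Fin n)) - 1 = 2 * n - 1 := by rw [aux_finrank]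
  have h := aux_polar_mul (volume : Measure (EuclideanSpace ℂ (Fin n)))
    (fun z => auxP α β z * (Real.exp (-‖z‖^2) : ℂ))
    (fun ρ => (ρ:ℂ) ^ (∑ i, α i + ∑ i, β i) * (Real.exp (-ρ^2) : ℂ)) (fun z => auxP α β z) (by
      intro z ρ hρ
      simp only [auxP_rsmul]
      simp [norm_smul]
      ring)
  rw [hf] at h
  have h2 : ∫ ρ in Ioi (0:ℝ), (ρ:ℂ) ^ (2 * n - 1) * 
      ((ρ:ℂ) ^ (∑ i, α i + ∑ i, β i) * (Real.exp (-ρ^2) : ℂ)) = 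
      ((n - 1 + ∑ i, β i).factorial : ℂ) / 2 := by
    rw [← aux_gauss_int]
    congr 1
    ext ρ
    rw [← mul_assoc, ← pow_add]
    congr 2
    omega
  rw [h2] at h
  have h3 := aux_gauss_moment α β
  unfold auxP at h ⊢
  rw [h3] at h
  have hfa : ((n - 1 + ∑ i, β i).factorial : ℂ) ≠ 0 := by exact_mod_cast Nat.factorial_ne_zero _
  have hfb : ((n - 1).factorial : ℂ) ≠ 0 := by exact_mod_cast Nat.factorial_ne_zero _
  have hle : α ≤ β ↔ α = β := by
    refine ⟨fun h => ?_, fun h => h.le⟩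
    ext j
    exact (Finset.sum_eq_sum_iff_of_le (fun i _ => h i)).1 hαβ.symm j (Finset.mem_univ j)
  unfold aCoef sigmaTot
  by_cases hab : α = β
  · rw [if_pos hab] at h
    rw [if_pos (hle.2 hab)]
    push_cast
    field_simp
    field_simp at h
    linear_combination -h
  · rw [if_neg hab] at h
    rw [if_neg (fun h => hab (hle.1 h))]
    have := h.symm
    simp only [mul_eq_zero, div_eq_zero_iff, hfa, OfNat.ofNat_ne_zero, or_false] at this
    rw [this]
    simp

lemma aux_Rbar (v : EuclideanSpace ℂ (Fin n) → ℂ) (z : EuclideanSpace ℂ (Fin n)) :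
    Rbar v z = (1/2 : ℂ) * (fderiv ℝ v z z + Complex.I * fderiv ℝ v z (Complex.I • z)) := by
  set D := fderiv ℝ v z
  have h1 : z = ∑ j, ((z j).re • EuclideanSpace.single j (1:ℂ) + 
      (z j).im • EuclideanSpace.single j Complex.I) := by
    ext i
    simp [Finset.sum_add_distrib, Pi.single_apply]
  have h2 : Complex.I • z = ∑ j, ((-(z j).im) • EuclideanSpace.single j (1:ℂ) + 
      (z j).re • EuclideanSpace.single j Complex.I) := by
    ext i
    simp [Finset.sum_add_distrib, Pi.single_apply]
    apply Complex.ext <;> simp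
  have e1 : D z = ∑ j, ((z j).re * D (EuclideanSpace.single j (1:ℂ)) + 
      (z j).im * D (EuclideanSpace.single j Complex.I)) := by
    conv_lhs => rw [h1]
    simp only [map_sum, map_add, map_smul, Complex.real_smul]
  have e2 : D (Complex.I • z) = ∑ j, (-(z j).im * D (EuclideanSpace.single j (1:ℂ)) + 
      (z j).re * D (EuclideanSpace.single j Complex.I)) := by
    conv_lhs => rw [h2]
    simp only [map_sum, map_add, map_smul, Complex.real_smul, Complex.ofReal_neg]
  rw [e1, e2, Rbar, Finset.mul_sum, ← Finset.sum_add_distrib, Finset.mul_sum]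
  refine Finset.sum_congr rfl fun j _ => ?_
  have hc : (starRingEnd ℂ) (z j) = (z j).re - (z j).im * Complex.I := by
    apply Complex.ext <;> simp
  rw [hc, wdbar]
  linear_combination (- (1/2 : ℂ) * (z j).im * D (EuclideanSpace.single j Complex.I)) * Complex.I_sq
end momSec

section anaSec
open Set Metric
variable {n : ℕ}

lemma aux_rot_sphere (hn : 1 ≤ n) (θ : ℝ) (f : EuclideanSpace ℂ (Fin n) → ℂ) :
    ∫ z : sphere (0 : EuclideanSpace ℂ (Fin n)) 1, f (Complex.exp (θ * Complex.I) • (z : EuclideanSpace ℂ (Fin n)))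
      ∂(volume : Measure (EuclideanSpace ℂ (Fin n))).toSphere
    = ∫ z : sphere (0 : EuclideanSpace ℂ (Fin n)) 1, f z
      ∂(volume : Measure (EuclideanSpace ℂ (Fin n))).toSphere := by
  have := aux_nontriv hn
  let c := Complex.exp (θ * Complex.I)
  have hc : ‖c‖ = 1 := Complex.norm_exp_ofReal_mul_I θ
  have hc0 : c ≠ 0 := Complex.exp_ne_zero _
  let L : EuclideanSpace ℂ (Fin n) ≃ₗ[ℝ] EuclideanSpace ℂ (Fin n) :=
    (LinearEquiv.smulOfUnit (Units.mk0 c hc0) : EuclideanSpace ℂ (Fin n) ≃ₗ[ℂ] EuclideanSpace ℂ (Fin n)).restrictScalars ℝ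
  have hL : ∀ x, ‖L x‖ = ‖x‖ := by
    intro x
    change ‖c • x‖ = ‖x‖
    rw [norm_smul, hc, one_mul]
  let A : EuclideanSpace ℂ (Fin n) ≃ₗᵢ[ℝ] EuclideanSpace ℂ (Fin n) :=
    ⟨L, hL⟩
  have hA : MeasurePreserving A volume volume := A.measurePreserving
  exact aux_sphere_inv volume A hA ⟨n - 1, by rw [aux_finrank]; omega⟩ f

lemma aux_deriv_int {X : Type*} [TopologicalSpace X] [CompactSpace X] [MeasurableSpace X] [BorelSpace X]
    [SecondCountableTopology X]
    (σ : Measure X) [IsFiniteMeasure σ] (F F' : ℝ → X → ℂ) (hFc : ∀ θ, Continuous (F θ))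
    (hF'c : Continuous (fun p : ℝ × X => F' p.1 p.2))
    (hdd : ∀ z θ, HasDerivAt (fun θ => F θ z) (F' θ z) θ) :
    HasDerivAt (fun θ => ∫ z, F θ z ∂σ) (∫ z, F' 0 z ∂σ) 0 := by
  obtain ⟨C, hC⟩ := ((isCompact_Icc (a := (-1:ℝ)) (b := 1)).prod 
    (isCompact_univ (X := X))).exists_bound_of_continuousOn hF'c.continuousOn
  exact (hasDerivAt_integral_of_dominated_loc_of_deriv_le (μ := σ) (F := F) (F' := F') (x₀ := (0:ℝ))
    (s := Icc (-1) 1) (bound := fun _ => C) (Icc_mem_nhds (by norm_num) (by norm_num))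
    (.of_forall fun θ => (hFc θ).aestronglyMeasurable)
    ((hFc 0).integrable_of_hasCompactSupport (HasCompactSupport.of_compactSpace _)) 
    (Continuous.aestronglyMeasurable (hF'c.comp (by fun_prop : Continuous fun z => ((0:ℝ), z))))
    (.of_forall fun z θ hθ => hC (θ, z) ⟨hθ, mem_univ _⟩)
    (integrable_const _) (.of_forall fun z θ _ => hdd z θ)).2

set_option maxHeartbeats 400000 in
lemma aux_angular (hn : 1 ≤ n) (α β : Fin n → ℕ) (k : ℕ) (hk : ∑ i, α i = k + ∑ i, β i)
    (v : EuclideanSpace ℂ (Fin n) → ℂ) (hv : ContDiff ℝ 1 v) (ρ : ℝ) :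
    ∫ z : sphere (0 : EuclideanSpace ℂ (Fin n)) 1, auxP α β z *
      (ρ * Complex.I * fderiv ℝ v (ρ • (z : EuclideanSpace ℂ (Fin n))) (Complex.I • (z : EuclideanSpace ℂ (Fin n))))
      ∂(volume : Measure (EuclideanSpace ℂ (Fin n))).toSphere
    = ∫ z : sphere (0 : EuclideanSpace ℂ (Fin n)) 1, auxP α β z * (k * v (ρ • (z : EuclideanSpace ℂ (Fin n))))
      ∂(volume : Measure (EuclideanSpace ℂ (Fin n))).toSphere := by
  set σ := (volume : Measure (EuclideanSpace ℂ (Fin n))).toSphere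
  have hP := auxP_cont α β
  have hvc : Continuous v := hv.continuous
  have hDc : Continuous (fderiv ℝ v) := hv.continuous_fderiv one_ne_zero
  have hint : ∀ f : sphere (0 : EuclideanSpace ℂ (Fin n)) 1 → ℂ, Continuous f → Integrable f σ :=
    fun f hf => hf.integrable_of_hasCompactSupport (HasCompactSupport.of_compactSpace f)
  let e : ℝ → ℂ := fun θ => Complex.exp (θ * Complex.I)
  have hec : Continuous e := by fun_prop
  have hed : ∀ θ, HasDerivAt e (e θ * Complex.I) θ := by
    intro θ
    have := ((Complex.ofRealCLM.hasDerivAt (x := θ)).mul_const Complex.I).cexp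
    simpa [e] using this
  let F : ℝ → sphere (0 : EuclideanSpace ℂ (Fin n)) 1 → ℂ := fun θ z =>
    e θ ^ k * auxP α β z * v (ρ • e θ • (z : EuclideanSpace ℂ (Fin n)))
  let F' : ℝ → sphere (0 : EuclideanSpace ℂ (Fin n)) 1 → ℂ := fun θ z =>
    k * Complex.I * e θ ^ k * auxP α β z * v (ρ • e θ • (z : EuclideanSpace ℂ (Fin n))) + 
    e θ ^ k * auxP α β z * fderiv ℝ v (ρ • e θ • (z : EuclideanSpace ℂ (Fin n))) 
      (ρ • (e θ * Complex.I) • (z : EuclideanSpace ℂ (Fin n)))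
  have hFc : ∀ θ, Continuous (F θ) := by
    intro θ
    fun_prop
  have hF'c : Continuous (fun p : ℝ × sphere (0 : EuclideanSpace ℂ (Fin n)) 1 => F' p.1 p.2) := by
    have : Continuous (fun p : ℝ × sphere (0 : EuclideanSpace ℂ (Fin n)) 1 => 
      fderiv ℝ v (ρ • e p.1 • (p.2 : EuclideanSpace ℂ (Fin n))) 
      (ρ • (e p.1 * Complex.I) • (p.2 : EuclideanSpace ℂ (Fin n)))) := by
      apply Continuous.clm_apply
      · exact hDc.comp (by fun_prop)
      · fun_prop
    simp only [F']
    fun_prop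
  have hdd : ∀ z θ, HasDerivAt (fun θ => F θ z) (F' θ z) θ := by
    intro z θ
    have h1 := ((hed θ).pow k).mul_const (auxP α β z)
    have h2 : HasDerivAt (fun θ => ρ • e θ • (z : EuclideanSpace ℂ (Fin n))) 
        (ρ • (e θ * Complex.I) • (z : EuclideanSpace ℂ (Fin n))) θ :=
        ((hed θ).smul_const (z : EuclideanSpace ℂ (Fin n))).const_smul ρ
    have h3 := ((hv.differentiable one_ne_zero _).hasFDerivAt.comp_hasDerivAt θ h2)
    have h4 := h1.mul h3
    refine h4.congr_deriv ?_
    rcases k with _ | k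
    · simp [F']
    · simp only [F', Nat.add_sub_cancel, Function.comp_apply, Pi.pow_apply]
      push_cast
      ring
  have hder := aux_deriv_int σ F F' hFc hF'c hdd
  have hconst : ∀ θ, ∫ z, F θ z ∂σ = ∫ z, F 0 z ∂σ := by
    intro θ
    have := aux_rot_sphere hn θ (fun z => auxP α β z * v (ρ • z))
    have hF0 : ∀ z, F 0 z = auxP α β z * v (ρ • z) := by
      intro z; simp [F, e]
    simp_rw [hF0]
    rw [← this]
    congr 1
    ext z
    have hee : e θ * (starRingEnd ℂ) (e θ) = 1 := by
      rw [Complex.mul_conj, Complex.normSq_eq_norm_sq, Complex.norm_exp_ofReal_mul_I]; simp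
    have : auxP α β (e θ • (z : EuclideanSpace ℂ (Fin n))) = e θ ^ k * auxP α β z := by
      rw [auxP_smul, hk, pow_add, mul_assoc (e θ ^ k), ← mul_pow, hee]; simp
    change _ = auxP α β (e θ • (z : EuclideanSpace ℂ (Fin n))) * _
    rw [this]
  have hz : ∫ z, F' 0 z ∂σ = 0 := by
    refine hder.unique ?_
    have : (fun θ => ∫ z, F θ z ∂σ) = fun _ => ∫ z, F 0 z ∂σ := funext hconst
    rw [this]
    exact hasDerivAt_const _ _
  have hDc2 : Continuous (fun z : sphere (0 : EuclideanSpace ℂ (Fin n)) 1 => 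
      fderiv ℝ v (ρ • (z : EuclideanSpace ℂ (Fin n))) (Complex.I • (z : EuclideanSpace ℂ (Fin n)))) := by
    apply Continuous.clm_apply
    · exact hDc.comp (by fun_prop)
    · fun_prop
  rw [← sub_eq_zero, ← integral_sub (hint _ (by fun_prop)) (hint _ (by fun_prop))]
  have : ∫ z, Complex.I * F' 0 z ∂σ = 0 := by rw [integral_const_mul, hz, mul_zero]
  rw [← this]
  congr 1
  ext z
  simp only [F', e]
  simp
  linear_combination (-(k:ℂ) * auxP α β z * v (ρ • (z : EuclideanSpace ℂ (Fin n)))) * Complex.I_sq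

lemma aux_prod_int (r : ℝ) (u : sphere (0 : EuclideanSpace ℂ (Fin n)) 1 × ℝ → ℂ) (hu : Continuous u) :
    Integrable u ((volume : Measure (EuclideanSpace ℂ (Fin n))).toSphere.prod (volume.restrict (Ioo 0 r))) := by
  have h := hu.continuousOn.integrableOn_compact (μ := (volume : Measure (EuclideanSpace ℂ (Fin n))).toSphere.prod volume)
    ((isCompact_univ (X := sphere (0 : EuclideanSpace ℂ (Fin n)) 1)).prod (isCompact_Icc (a := (0:ℝ)) (b := r)))
  have h2 := h.mono_set (Set.prod_mono (Subset.refl univ) (Ioo_subset_Icc_self (a := (0:ℝ)) (b := r)))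
  rw [IntegrableOn, ← Measure.prod_restrict, Measure.restrict_univ] at h2
  exact h2

lemma aux_core (hn : 1 ≤ n) (α β : Fin n → ℕ) (k : ℕ) (hk : ∑ i, α i = k + ∑ i, β i)
    (v : EuclideanSpace ℂ (Fin n) → ℂ) (hv : ContDiff ℝ 1 v) (r : ℝ) (hr : 0 < r) :
    ∫ p : sphere (0 : EuclideanSpace ℂ (Fin n)) 1 × ℝ, auxP α β p.1 * (p.2:ℂ) ^ k * 
      (fderiv ℝ v (p.2 • (p.1 : EuclideanSpace ℂ (Fin n))) p.1 + 
        Complex.I * fderiv ℝ v (p.2 • (p.1 : EuclideanSpace ℂ (Fin n))) (Complex.I • (p.1 : EuclideanSpace ℂ (Fin n))))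
      ∂((volume : Measure (EuclideanSpace ℂ (Fin n))).toSphere.prod (volume.restrict (Ioo 0 r)))
    = (r:ℂ) ^ k * (∫ z : sphere (0 : EuclideanSpace ℂ (Fin n)) 1, auxP α β z * v (r • (z : EuclideanSpace ℂ (Fin n)))
      ∂(volume : Measure (EuclideanSpace ℂ (Fin n))).toSphere) - 
      0 ^ k * v 0 * (∫ z : sphere (0 : EuclideanSpace ℂ (Fin n)) 1, auxP α β z 
      ∂(volume : Measure (EuclideanSpace ℂ (Fin n))).toSphere) := by
  set σ := (volume : Measure (EuclideanSpace ℂ (Fin n))).toSphere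
  have hP := auxP_cont α β
  have hvc : Continuous v := hv.continuous
  have hDc : Continuous (fderiv ℝ v) := hv.continuous_fderiv one_ne_zero
  have hint : ∀ f : sphere (0 : EuclideanSpace ℂ (Fin n)) 1 → ℂ, Continuous f → Integrable f σ :=
    fun f hf => hf.integrable_of_hasCompactSupport (HasCompactSupport.of_compactSpace f)
  let u1 : sphere (0 : EuclideanSpace ℂ (Fin n)) 1 × ℝ → ℂ := fun p => auxP α β p.1 * ((p.2:ℂ) ^ k *
    fderiv ℝ v (p.2 • (p.1 : EuclideanSpace ℂ (Fin n))) p.1)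
  let u2 : sphere (0 : EuclideanSpace ℂ (Fin n)) 1 × ℝ → ℂ := fun p => auxP α β p.1 * ((p.2:ℂ) ^ k *
    (Complex.I * fderiv ℝ v (p.2 • (p.1 : EuclideanSpace ℂ (Fin n))) (Complex.I • (p.1 : EuclideanSpace ℂ (Fin n)))))
  let u3 : sphere (0 : EuclideanSpace ℂ (Fin n)) 1 × ℝ → ℂ := fun p => auxP α β p.1 * ((k * (p.2:ℂ) ^ (k-1)) *
    v (p.2 • (p.1 : EuclideanSpace ℂ (Fin n))))
  have c1 : Continuous u1 := by
    have : Continuous (fun p : sphere (0 : EuclideanSpace ℂ (Fin n)) 1 × ℝ => 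
        fderiv ℝ v (p.2 • (p.1 : EuclideanSpace ℂ (Fin n))) (p.1 : EuclideanSpace ℂ (Fin n))) :=
      Continuous.clm_apply (hDc.comp (by fun_prop)) (by fun_prop)
    fun_prop
  have c2 : Continuous u2 := by
    have : Continuous (fun p : sphere (0 : EuclideanSpace ℂ (Fin n)) 1 × ℝ => 
        fderiv ℝ v (p.2 • (p.1 : EuclideanSpace ℂ (Fin n))) (Complex.I • (p.1 : EuclideanSpace ℂ (Fin n)))) :=
      Continuous.clm_apply (hDc.comp (by fun_prop)) (by fun_prop)
    fun_prop
  have c3 : Continuous u3 := by fun_prop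
  have i1 := aux_prod_int r u1 c1
  have i2 := aux_prod_int r u2 c2
  have i3 := aux_prod_int r u3 c3
  have e23 : ∫ p, u2 p ∂(σ.prod (volume.restrict (Ioo 0 r))) = ∫ p, u3 p ∂(σ.prod (volume.restrict (Ioo 0 r))) := by
    rw [integral_prod_symm _ i2, integral_prod_symm _ i3]
    refine setIntegral_congr_fun measurableSet_Ioo fun ρ hρ => ?_
    have hρ0 : (ρ:ℂ) ≠ 0 := by exact_mod_cast hρ.1.ne'
    have := congrArg (fun x => (ρ:ℂ) ^ k * (ρ:ℂ)⁻¹ * x) (aux_angular hn α β k hk v hv ρ)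
    simp only [← integral_const_mul] at this
    convert this using 1
    · congr 1
      ext z
      simp only [u2]
      field_simp
    · congr 1
      ext z
      simp only [u3]
      rcases k with _ | k
      · simp
      · field_simp
        simp
        ring
  calc _ = ∫ p, (u1 p + u2 p) ∂(σ.prod (volume.restrict (Ioo 0 r))) := by
        congr 1
        ext p
        simp only [u1, u2]
        ring
    _ = ∫ p, (u1 p + u3 p) ∂(σ.prod (volume.restrict (Ioo 0 r))) := by
        rw [integral_add i1 i2, integral_add i1 i3, e23]
    _ = ∫ z, auxP α β z * ((r:ℂ) ^ k * v (r • (z : EuclideanSpace ℂ (Fin n))) - 0 ^ k * v 0) ∂σ := by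
        have hadd : Integrable (fun p => u1 p + u3 p) (σ.prod (volume.restrict (Ioo 0 r))) := i1.add i3
        rw [integral_prod _ hadd]
        congr 1
        ext z
        rw [← integral_Ioc_eq_integral_Ioo, ← intervalIntegral.integral_of_le hr.le]
        have hd : ∀ ρ ∈ uIcc 0 r, HasDerivAt (fun ρ : ℝ => auxP α β z * ((ρ:ℂ) ^ k * v (ρ • (z : EuclideanSpace ℂ (Fin n)))))
            (u1 (z, ρ) + u3 (z, ρ)) ρ := by
          intro ρ _
          have h2 : HasDerivAt (fun ρ : ℝ => ρ • (z : EuclideanSpace ℂ (Fin n))) (z : EuclideanSpace ℂ (Fin n)) ρ := by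
            simpa using (hasDerivAt_id ρ).smul_const (z : EuclideanSpace ℂ (Fin n))
          have h3 := ((hv.differentiable one_ne_zero _).hasFDerivAt.comp_hasDerivAt ρ h2)
          have h1 := (Complex.ofRealCLM.hasDerivAt (x := ρ)).pow k
          have h4 := (h1.mul h3).const_mul (auxP α β z)
          refine h4.congr_deriv ?_
          simp only [u1, u3, Function.comp_apply, Pi.pow_apply, Complex.ofRealCLM_apply, Complex.ofReal_one]
          ring
        have c4 : Continuous (fun ρ => u1 (z, ρ) + u3 (z, ρ)) := by fun_prop
        rw [intervalIntegral.integral_eq_sub_of_hasDerivAt hd (c4.intervalIntegrable _ _)]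
        simp
        ring
    _ = _ := by
        rw [← integral_const_mul, ← integral_const_mul, ← integral_sub (hint _ (by fun_prop)) (hint _ (by fun_prop))]
        congr 1
        ext z
        ring
end anaSec

section finSec
open Set Metric
variable {n : ℕ}

lemma aux_ext (r : ℝ) (hr : 0 < r) (v : EuclideanSpace ℂ (Fin n) → ℂ)
    (hv : ∃ U : Set (EuclideanSpace ℂ (Fin n)), IsOpen U ∧
      Metric.closedBall (0 : EuclideanSpace ℂ (Fin n)) r ⊆ U ∧ ContDiffOn ℝ 1 v U) :
    ∃ w : EuclideanSpace ℂ (Fin n) → ℂ, ContDiff ℝ 1 w ∧ 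
      ∃ R, r < R ∧ ∀ z ∈ ball (0 : EuclideanSpace ℂ (Fin n)) R, w z = v z := by
  obtain ⟨U, hU, hsub, hd⟩ := hv
  obtain ⟨δ, hδ, hδU⟩ := (isCompact_closedBall (0 : EuclideanSpace ℂ (Fin n)) r).exists_cthickening_subset_open hU hsub
  rw [cthickening_closedBall hδ.le hr.le] at hδU
  let b : ContDiffBump (0 : EuclideanSpace ℂ (Fin n)) := ⟨r + δ/2, r + δ, by positivity, by linarith⟩
  refine ⟨fun z => (b z : ℝ) • v z, ?_, r + δ/2, by linarith, ?_⟩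
  · rw [contDiff_iff_contDiffAt]
    intro z
    by_cases hz : z ∈ U
    · exact b.contDiffAt.smul (hd.contDiffAt (hU.mem_nhds hz))
    · have hz2 : z ∈ (closedBall (0 : EuclideanSpace ℂ (Fin n)) (r+δ))ᶜ := fun h => hz (hδU (by rwa [add_comm]))
      refine (contDiffAt_const (c := (0:ℂ))).congr_of_eventuallyEq ?_
      filter_upwards [isClosed_closedBall.isOpen_compl.mem_nhds hz2] with y hy
      have : b y = 0 := by
        apply b.zero_of_le_dist
        have : ¬ dist y 0 ≤ r + δ := hy
        exact (not_le.1 this).le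
      simp [this]
  · intro z hz
    have : b z = 1 := b.one_of_mem_closedBall (ball_subset_closedBall hz)
    simp [this]

lemma aux_lhs (r : ℝ) (hr : 0 < r) (f : EuclideanSpace ℂ (Fin n) → ℂ) :
    ∫ z, f z ∂(sphereMeas n r) = (r:ℂ) ^ (2 * n - 1) * 
      ∫ z : sphere (0 : EuclideanSpace ℂ (Fin n)) 1, f (r • (z : EuclideanSpace ℂ (Fin n))) 
        ∂(volume : Measure (EuclideanSpace ℂ (Fin n))).toSphere := by
  have he : MeasurableEmbedding (fun x : sphere (0 : EuclideanSpace ℂ (Fin n)) 1 =>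
        r • (x : EuclideanSpace ℂ (Fin n))) :=
    (Homeomorph.smulOfNeZero r hr.ne').measurableEmbedding.comp
      (MeasurableEmbedding.subtype_coe isClosed_sphere.measurableSet)
  rw [sphereMeas, integral_smul_measure, he.integral_map, ENNReal.toReal_ofReal (by positivity)]
  simp

lemma aux_ball (hn : 1 ≤ n) (r : ℝ) (f : EuclideanSpace ℂ (Fin n) → ℂ) :
    ∫ z in ball (0 : EuclideanSpace ℂ (Fin n)) r, f z = 
      ∫ p : sphere (0 : EuclideanSpace ℂ (Fin n)) 1 × ℝ, (p.2:ℂ) ^ (2 * n - 1) * f (p.2 • (p.1 : EuclideanSpace ℂ (Fin n)))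
      ∂((volume : Measure (EuclideanSpace ℂ (Fin n))).toSphere.prod (volume.restrict (Ioo 0 r))) := by
  have := aux_nontriv hn
  set σ := (volume : Measure (EuclideanSpace ℂ (Fin n))).toSphere with hσ
  have hm : MeasurableSet ((univ : Set (sphere (0 : EuclideanSpace ℂ (Fin n)) 1)) ×ˢ Iio r) :=
    MeasurableSet.univ.prod measurableSet_Iio
  have hres : σ.prod (volume.restrict (Ioo 0 r)) = (σ.prod (volume.restrict (Ioi (0:ℝ)))).restrict (univ ×ˢ Iio r) := by
    rw [← Measure.prod_restrict, Measure.restrict_univ, Measure.restrict_restrict measurableSet_Iio]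
    congr 2
    ext x; simp [and_comm]
  rw [← integral_indicator measurableSet_ball, aux_polar, hres, ← integral_indicator hm, aux_finrank]
  have hpos : ∀ᵐ p ∂(σ.prod (volume.restrict (Ioi (0:ℝ)))), (p : sphere (0 : EuclideanSpace ℂ (Fin n)) 1 × ℝ).2 ∈ Ioi (0:ℝ) := by
    have : σ.prod (volume.restrict (Ioi (0:ℝ))) = (σ.prod volume).restrict (univ ×ˢ Ioi 0) := by
      rw [← Measure.prod_restrict, Measure.restrict_univ]
    rw [this]
    filter_upwards [ae_restrict_mem (MeasurableSet.univ.prod measurableSet_Ioi)] with p hp using hp.2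
  refine integral_congr_ae ?_
  filter_upwards [hpos] with p hp
  have hz : ‖(p.1 : EuclideanSpace ℂ (Fin n))‖ = 1 := by simpa using p.1.2
  have hnorm : ‖p.2 • (p.1 : EuclideanSpace ℂ (Fin n))‖ = p.2 := by
    rw [norm_smul, hz, mul_one, Real.norm_of_nonneg (le_of_lt hp)]
  by_cases h : p.2 < r
  · rw [indicator_of_mem (by rw [mem_ball_zero_iff, hnorm]; exact h), 
      indicator_of_mem (show p ∈ univ ×ˢ Iio r from ⟨mem_univ _, h⟩)]
    simp
  · rw [indicator_of_notMem (by rw [mem_ball_zero_iff, hnorm]; exact h), 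
      indicator_of_notMem (show p ∉ univ ×ˢ Iio r from fun hh => h hh.2)]
    simp

lemma aux_final (hn : 1 ≤ n) (r : ℝ) (hr : 0 < r) (α β : Fin n → ℕ) (k : ℕ) (hk : ∑ i, α i = k + ∑ i, β i)
    (v : EuclideanSpace ℂ (Fin n) → ℂ)
    (hv : ∃ U : Set (EuclideanSpace ℂ (Fin n)), IsOpen U ∧
      Metric.closedBall (0 : EuclideanSpace ℂ (Fin n)) r ⊆ U ∧ ContDiffOn ℝ 1 v U) :
    (∫ z, auxP α β z * v z ∂(sphereMeas n r))
      = ((aCoef n α β * sigmaTot n * r ^ (2 * (∑ i, β i) + 2 * n - 1) : ℝ) : ℂ) * v 0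
        + ((2 * r ^ (2 * (∑ i, β i) + 2 * n - 1) : ℝ) : ℂ) *
          ∫ z in Metric.ball (0 : EuclideanSpace ℂ (Fin n)) r,
            auxP α β z *
              (((‖z‖ ^ (2 * (∑ i, β i) + 2 * n) : ℝ) : ℂ))⁻¹ * Rbar v z := by
  obtain ⟨w, hw, R, hR, hwv⟩ := aux_ext r hr v hv
  have hcore := aux_core hn α β k hk w hw r hr
  set σ := (volume : Measure (EuclideanSpace ℂ (Fin n))).toSphere with hσ
  set b := ∑ i, β i with hb
  have hnz : ∀ z : sphere (0 : EuclideanSpace ℂ (Fin n)) 1, ‖(z : EuclideanSpace ℂ (Fin n))‖ = 1 := by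
    intro z; simpa using z.2
  have hmom : (0:ℂ) ^ k * w 0 * ∫ z : sphere (0 : EuclideanSpace ℂ (Fin n)) 1, auxP α β z ∂σ = 
      ((aCoef n α β * sigmaTot n : ℝ) : ℂ) * v 0 := by
    have h0 : w 0 = v 0 := hwv 0 (mem_ball_self (by linarith))
    rcases Nat.eq_zero_or_pos k with h | h
    · rw [aux_sphere_moment hn α β (by omega), h0, h]
      ring
    · have : ¬ α ≤ β := by
        intro hle
        have : ∑ i, α i ≤ ∑ i, β i := Finset.sum_le_sum fun i _ => hle i
        omega
      rw [aCoef, if_neg this, zero_pow h.ne']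
      simp
  have hball : ∫ z in ball (0 : EuclideanSpace ℂ (Fin n)) r,
            auxP α β z * (((‖z‖ ^ (2 * b + 2 * n) : ℝ) : ℂ))⁻¹ * Rbar v z = (1/2 : ℂ) * 
      ((r:ℂ) ^ k * (∫ z : sphere (0 : EuclideanSpace ℂ (Fin n)) 1, auxP α β z * w (r • (z : EuclideanSpace ℂ (Fin n)))
      ∂σ) - ((aCoef n α β * sigmaTot n : ℝ) : ℂ) * v 0) := by
    rw [← hmom, ← hcore, aux_ball hn, ← integral_const_mul]
    have hr2 : ∀ᵐ p ∂(σ.prod (volume.restrict (Ioo (0:ℝ) r))), (p : sphere (0 : EuclideanSpace ℂ (Fin n)) 1 × ℝ).2 ∈ Ioo (0:ℝ) r := by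
      have : σ.prod (volume.restrict (Ioo (0:ℝ) r)) = (σ.prod volume).restrict (univ ×ˢ Ioo 0 r) := by
        rw [← Measure.prod_restrict, Measure.restrict_univ]
      rw [this]
      filter_upwards [ae_restrict_mem (MeasurableSet.univ.prod measurableSet_Ioo)] with p hp using hp.2
    refine integral_congr_ae ?_
    filter_upwards [hr2] with p hp
    obtain ⟨z, ρ⟩ := p
    simp only at hp ⊢
    have hnorm : ‖ρ • (z : EuclideanSpace ℂ (Fin n))‖ = ρ := by
      rw [norm_smul, hnz, mul_one, Real.norm_of_nonneg (le_of_lt hp.1)]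
    have hfd : fderiv ℝ v (ρ • (z : EuclideanSpace ℂ (Fin n))) = fderiv ℝ w (ρ • (z : EuclideanSpace ℂ (Fin n))) := by
      apply Filter.EventuallyEq.fderiv_eq
      filter_upwards [isOpen_ball.mem_nhds (show ρ • (z : EuclideanSpace ℂ (Fin n)) ∈ ball (0 : EuclideanSpace ℂ (Fin n)) R by
        rw [mem_ball_zero_iff, hnorm]; linarith [hp.2])] with y hy using (hwv y hy).symm
    have hI : Complex.I • ρ • (z : EuclideanSpace ℂ (Fin n)) = ρ • Complex.I • (z : EuclideanSpace ℂ (Fin n)) := smul_comm _ _ _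
    rw [hnorm, aux_Rbar, hfd, hI, map_smul, map_smul, auxP_rsmul, hk]
    simp only [Complex.real_smul]
    have hρ : (ρ:ℂ) ≠ 0 := by exact_mod_cast hp.1.ne'
    obtain ⟨m, rfl⟩ : ∃ m, n = m + 1 := ⟨n - 1, by omega⟩
    have e1 : 2 * (m+1) - 1 = 2 * m + 1 := by omega
    rw [e1]
    push_cast
    field_simp
    ring
  have hl : ∫ z, auxP α β z * v z ∂(sphereMeas n r) = (r:ℂ) ^ (2 * n - 1) * ((r:ℂ) ^ (k + 2 * b) * 
      ∫ z : sphere (0 : EuclideanSpace ℂ (Fin n)) 1, auxP α β z * w (r • (z : EuclideanSpace ℂ (Fin n))) ∂σ) := by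
    rw [aux_lhs r hr]
    congr 1
    rw [← integral_const_mul]
    congr 1
    ext z
    rw [auxP_rsmul, hk, hwv (r • (z : EuclideanSpace ℂ (Fin n))) (by
      rw [mem_ball_zero_iff, norm_smul, hnz, mul_one, Real.norm_of_nonneg hr.le]; exact hR)]
    ring
  rw [hl, hball]
  have e2 : 2 * b + 2 * n - 1 = 2 * b + (2 * n - 1) := by omega
  rw [e2]
  push_cast
  ring
end finSec

/-- Generalized Bochner–Martinelli formula on spheres (Lemma 6.1): for multi-indices
`|α| ≥ |β|` and `v ∈ C¹` near the closed ball of radius `r`,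
`∫_{r𝕊ₙ} z^α conj(z)^β v dσ_r = a_{α,β} σ_{2n−1} r^{2|β|+2n−1} v(0)
  + 2 r^{2|β|+2n−1} ∫_{r𝔹ₙ} z^α conj(z)^β |z|^{−2|β|−2n} R̄v(z) dm(z)`. -/
theorem stmt14 (n : ℕ) (hn : 1 ≤ n) (r : ℝ) (hr : 0 < r) (α β : Fin n → ℕ)
    (hαβ : (∑ i, β i) ≤ ∑ i, α i)
    (v : EuclideanSpace ℂ (Fin n) → ℂ)
    (hv : ∃ U : Set (EuclideanSpace ℂ (Fin n)), IsOpen U ∧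
      Metric.closedBall (0 : EuclideanSpace ℂ (Fin n)) r ⊆ U ∧ ContDiffOn ℝ 1 v U) :
    (∫ z, (∏ j, z j ^ α j) * (∏ j, (starRingEnd ℂ) (z j) ^ β j) * v z ∂(sphereMeas n r))
      = ((aCoef n α β * sigmaTot n * r ^ (2 * (∑ i, β i) + 2 * n - 1) : ℝ) : ℂ) * v 0
        + ((2 * r ^ (2 * (∑ i, β i) + 2 * n - 1) : ℝ) : ℂ) *
          ∫ z in Metric.ball (0 : EuclideanSpace ℂ (Fin n)) r,
            (∏ j, z j ^ α j) * (∏ j, (starRingEnd ℂ) (z j) ^ β j) *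
              (((‖z‖ ^ (2 * (∑ i, β i) + 2 * n) : ℝ) : ℂ))⁻¹ * Rbar v z := by
  obtain ⟨k, hk⟩ := Nat.exists_eq_add_of_le' hαβ
  exact aux_final hn r hr α β k hk v hv
end

section
/- Let n ≥ 1 and t > −1. (1) For every function v of class C¹ on a neighborhood of the closed unit ball, ∫_{𝔹ₙ} v dλ_t = v(0) + ((t+1)/(n+t+1))·∫_{𝔹ₙ} 𝓖^{(t)}_n 1(|z|²)·(R̄v)(z) dλ_{t+1}(z). (2) There exist ε > 0 and 0 < c₁ ≤ c₂ with c₁·s^{−n} ≤ 𝓖^{(t)}_n 1(s) ≤ c₂·s^{−n} for all s ∈ (0,ε), and lim_{s→1⁻} 𝓖^{(t)}_n 1(s) = 1/(t+1). (3) There exist C > 0 and δ > 0 such that |𝓖^{(t)}_n 1(s) − 1/(t+1)| ≤ C·(1−s) for all s ∈ (1−δ, 1). -/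
open MeasureTheory

/-- The Euler Beta function `B(x,y) = Γ(x)Γ(y)/Γ(x+y)`. -/
noncomputable def Bfun (x y : ℝ) : ℝ := Real.Gamma x * Real.Gamma y / Real.Gamma (x + y)

/-- The probability measure `dλ_t(z) = ((n−1)!/(πⁿ B(n,t+1)))(1−|z|²)^t dm(z)` on `𝔹ₙ`. -/
noncomputable def lambdaMeasure (n : ℕ) (t : ℝ) : Measure (EuclideanSpace ℂ (Fin n)) :=
  ((volume : Measure (EuclideanSpace ℂ (Fin n))).restrict (Metric.ball 0 1)).withDensity
    fun z => ENNReal.ofReal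
      ((Nat.factorial (n - 1) : ℝ) / (Real.pi ^ n * Bfun n (t + 1)) * (1 - ‖z‖ ^ 2) ^ t)

lemma aux_int1 (t : ℝ) (ht : -1 < t) (s : ℝ) (hs1 : s < 1) :
    IntegrableOn (fun r : ℝ => (1 - r) ^ t) (Set.Ioo s 1) ∧
    ∫ r in Set.Ioo s 1, (1 - r) ^ t = (1 - s) ^ (t + 1) / (t + 1) := by
  have h0 : IntervalIntegrable (fun x : ℝ => x ^ t) volume 0 (1 - s) :=
    intervalIntegral.intervalIntegrable_rpow' ht
  have h1 := h0.comp_sub_left 1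
  simp only [sub_zero, sub_sub_cancel] at h1
  constructor
  · exact ((intervalIntegrable_iff_integrableOn_Ioo_of_le hs1.le).1 h1.symm)
  · rw [← integral_Ioc_eq_integral_Ioo, ← intervalIntegral.integral_of_le hs1.le,
      intervalIntegral.integral_comp_sub_left (fun x => x ^ t) 1, sub_self,
      integral_rpow (Or.inl ht), Real.zero_rpow (by linarith)]
    simp

lemma aux_int2 (t : ℝ) (ht : -1 < t) (m : ℕ) (s : ℝ) (hs0 : 0 ≤ s) (hs1 : s < 1) :
    IntegrableOn (fun r : ℝ => r ^ m * 1 * (1 - r) ^ t) (Set.Ioo s 1) := by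
  refine Integrable.bdd_mul (c := 1) (aux_int1 t ht s hs1).1 ?_ ?_
  · exact (Continuous.aestronglyMeasurable (by fun_prop))
  · filter_upwards [self_mem_ae_restrict measurableSet_Ioo] with r hr
    have : 0 ≤ r := hs0.trans hr.1.le
    rw [mul_one, Real.norm_of_nonneg (by positivity)]
    exact pow_le_one₀ this hr.2.le

lemma Ft_le (t : ℝ) (ht : -1 < t) (m : ℕ) (s : ℝ) (hs0 : 0 ≤ s) (hs1 : s < 1) :
    Ft t m (fun _ => 1) s ≤ (1 - s) ^ (t + 1) / (t + 1) := by
  rw [← (aux_int1 t ht s hs1).2]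
  refine setIntegral_mono_on (aux_int2 t ht _ s hs0 hs1) (aux_int1 t ht s hs1).1
    measurableSet_Ioo ?_
  intro r hr
  have h0 : 0 ≤ r := hs0.trans hr.1.le
  have h1 : 0 ≤ (1 - r) ^ t := Real.rpow_nonneg (by linarith [hr.2]) _
  have h2 : r ^ (m - 1) ≤ 1 := pow_le_one₀ h0 hr.2.le
  nlinarith

lemma le_Ft (t : ℝ) (ht : -1 < t) (m : ℕ) (s : ℝ) (hs0 : 0 ≤ s) (hs1 : s < 1) :
    s ^ (m - 1) * ((1 - s) ^ (t + 1) / (t + 1)) ≤ Ft t m (fun _ => 1) s := by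
  rw [← (aux_int1 t ht s hs1).2, ← integral_const_mul]
  refine setIntegral_mono_on ((aux_int1 t ht s hs1).1.const_mul _) (aux_int2 t ht _ s hs0 hs1)
    measurableSet_Ioo ?_
  intro r hr
  have h1 : 0 ≤ (1 - r) ^ t := Real.rpow_nonneg (by linarith [hr.2]) _
  have h2 : s ^ (m - 1) ≤ r ^ (m - 1) := pow_le_pow_left₀ hs0 hr.1.le _
  simp only [mul_one]
  exact mul_le_mul_of_nonneg_right h2 h1

lemma Ft_anti (t : ℝ) (ht : -1 < t) (m : ℕ) (s s' : ℝ) (hs0 : 0 ≤ s) (hs : s ≤ s')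
    (hs1 : s' < 1) : Ft t m (fun _ => 1) s' ≤ Ft t m (fun _ => 1) s := by
  refine setIntegral_mono_set (aux_int2 t ht _ s hs0 (hs.trans_lt hs1)) ?_
    (Filter.Eventually.of_forall (Set.Ioo_subset_Ioo_left hs))
  filter_upwards [self_mem_ae_restrict measurableSet_Ioo] with r hr
  have h0 : 0 ≤ r := hs0.trans hr.1.le
  have h1 : 0 ≤ (1 - r) ^ t := Real.rpow_nonneg (by linarith [hr.2]) _
  simp only [Pi.zero_apply, mul_one]
  positivity

lemma Gt_bounds (n : ℕ) (hn : 1 ≤ n) (t : ℝ) (ht : -1 < t) (s : ℝ) (hs0 : 0 < s) (hs1 : s < 1) :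
    1 / (t + 1) ≤ Gt t n (fun _ => 1) s ∧
    Gt t n (fun _ => 1) s ≤ (s ^ n)⁻¹ * (1 / (t + 1)) := by
  have h1 : 0 < (1 - s) ^ (t + 1) := Real.rpow_pos_of_pos (by linarith) _
  have h2 : 0 < s ^ n := by positivity
  have h3 : 0 < t + 1 := by linarith
  unfold Gt
  constructor
  · rw [le_div_iff₀ (by positivity)]
    refine le_trans ?_ (le_Ft t ht n s hs0.le hs1)
    have : s ^ n ≤ s ^ (n - 1) := pow_le_pow_of_le_one hs0.le hs1.le (by omega)
    calc _ = s ^ n * ((1 - s) ^ (t + 1) / (t + 1)) := by ring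
      _ ≤ _ := by gcongr
  · rw [div_le_iff₀ (by positivity)]
    refine (Ft_le t ht n s hs0.le hs1).trans (le_of_eq ?_)
    field_simp

lemma part3 (n : ℕ) (hn : 1 ≤ n) (t : ℝ) (ht : -1 < t) : (∃ C δ : ℝ, 0 < C ∧ 0 < δ ∧ ∀ s ∈ Set.Ioo (1 - δ) 1,
      |Gt t n (fun _ => 1) s - 1 / (t + 1)| ≤ C * (1 - s)) := by
  have h3 : 0 < t + 1 := by linarith
  refine ⟨2 ^ n * n * (1 / (t + 1)), 1 / 2, by positivity, by norm_num, ?_⟩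
  rintro s ⟨hs, hs1⟩
  have hs' : 1 / 2 < s := by linarith
  have hs0 : 0 < s := by linarith
  obtain ⟨ha, hb⟩ := Gt_bounds n hn t ht s hs0 hs1
  rw [abs_of_nonneg (by linarith)]
  have hp : 0 < s ^ n := by positivity
  have hB : 1 + (n : ℝ) * (s - 1) ≤ s ^ n := by
    have := one_add_mul_le_pow (a := s - 1) (by linarith) n
    simpa using this
  have hi : (s ^ n)⁻¹ ≤ 2 ^ n := by
    rw [← inv_pow]
    refine pow_le_pow_left₀ (by positivity) ?_ _
    rw [inv_le_comm₀ hs0 (by norm_num)]; linarith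
  have : (s ^ n)⁻¹ - 1 ≤ 2 ^ n * n * (1 - s) := by
    calc (s ^ n)⁻¹ - 1 = (s ^ n)⁻¹ * (1 - s ^ n) := by field_simp
      _ ≤ (s ^ n)⁻¹ * (n * (1 - s)) := by gcongr; linarith
      _ ≤ 2 ^ n * (n * (1 - s)) := by
        have : 0 ≤ 1 - s := by linarith
        gcongr
      _ = _ := by ring
  have h4 : 0 < 1 / (t + 1) := by positivity
  calc _ ≤ (s ^ n)⁻¹ * (1 / (t + 1)) - 1 / (t + 1) := by linarith
    _ = ((s ^ n)⁻¹ - 1) * (1 / (t + 1)) := by ring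
    _ ≤ 2 ^ n * n * (1 - s) * (1 / (t + 1)) := by gcongr
    _ = _ := by ring

lemma part2b (n : ℕ) (hn : 1 ≤ n) (t : ℝ) (ht : -1 < t) :
    Filter.Tendsto (fun s => Gt t n (fun _ => 1) s)
      (nhdsWithin 1 (Set.Iio 1)) (nhds (1 / (t + 1))) := by
  obtain ⟨C, δ, hC, hδ, h⟩ := part3 n hn t ht
  rw [tendsto_iff_norm_sub_tendsto_zero]
  refine squeeze_zero' (g := fun s => C * (1 - s)) (Filter.Eventually.of_forall fun _ => norm_nonneg _) ?_ ?_
  · filter_upwards [Ioo_mem_nhdsLT (show 1 - δ < 1 by linarith)] with s hs using h s hs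
  · have : Filter.Tendsto (fun s : ℝ => C * (1 - s)) (nhds 1) (nhds (C * (1 - 1))) :=
      Continuous.tendsto (by fun_prop) 1
    rw [sub_self, mul_zero] at this
    exact this.mono_left nhdsWithin_le_nhds

lemma part2a (n : ℕ) (hn : 1 ≤ n) (t : ℝ) (ht : -1 < t) :
    (∃ ε c₁ c₂ : ℝ, 0 < ε ∧ 0 < c₁ ∧ c₁ ≤ c₂ ∧
      ∀ s ∈ Set.Ioo (0 : ℝ) ε,
        c₁ * s ^ (-(n : ℝ)) ≤ Gt t n (fun _ => 1) s ∧
        Gt t n (fun _ => 1) s ≤ c₂ * s ^ (-(n : ℝ))) := by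
  have h3 : 0 < t + 1 := by linarith
  have hh : (0 : ℝ) < (1 / 2) ^ (t + 1) := Real.rpow_pos_of_pos (by norm_num) _
  refine ⟨1 / 2, (1 / 2) ^ (n - 1) * ((1 / 2) ^ (t + 1) / (t + 1)), 1 / (t + 1), by norm_num,
    by positivity, ?_, ?_⟩
  · have h1 : ((1 : ℝ) / 2) ^ (n - 1) ≤ 1 := pow_le_one₀ (by norm_num) (by norm_num)
    have h2 : ((1 : ℝ) / 2) ^ (t + 1) ≤ 1 :=
      Real.rpow_le_one (by norm_num) (by norm_num) h3.le
    calc _ ≤ 1 * ((1 / 2) ^ (t + 1) / (t + 1)) := by gcongr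
      _ ≤ _ := by rw [one_mul]; gcongr
  · rintro s ⟨hs0, hs⟩
    have hs1 : s < 1 := by linarith
    rw [Real.rpow_neg hs0.le, Real.rpow_natCast]
    refine ⟨?_, by rw [mul_comm]; exact (Gt_bounds n hn t ht s hs0 hs1).2⟩
    have h1 : 0 < (1 - s) ^ (t + 1) := Real.rpow_pos_of_pos (by linarith) _
    have h1' : (1 - s) ^ (t + 1) ≤ 1 := Real.rpow_le_one (by linarith) (by linarith) h3.le
    have h2 : 0 < s ^ n := by positivity
    unfold Gt
    rw [le_div_iff₀ (by positivity)]
    have hA := Ft_anti t ht n s (1 / 2) hs0.le hs.le (by norm_num)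
    have hB := le_Ft t ht n (1 / 2) (by norm_num) (by norm_num)
    rw [show (1 : ℝ) - 1 / 2 = 1 / 2 by norm_num] at hB
    refine le_trans ?_ (hB.trans hA)
    calc _ = (1 / 2) ^ (n - 1) * ((1 / 2) ^ (t + 1) / (t + 1)) * (1 - s) ^ (t + 1) := by
          field_simp
      _ ≤ _ := mul_le_of_le_one_right (by positivity) h1'

lemma Ft_zero (n : ℕ) (hn : 1 ≤ n) (t : ℝ) (ht : -1 < t) :
    Ft t n (fun _ => 1) 0 = Bfun n (t + 1) := by
  have hn' : (0 : ℝ) < n := by exact_mod_cast hn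
  have h := ProbabilityTheory.beta_eq_betaIntegralReal n (t + 1) hn' (by linarith)
  have h' : Bfun n (t + 1) = ProbabilityTheory.beta n (t + 1) := rfl
  rw [h', h, Complex.betaIntegral, Ft, intervalIntegral.integral_of_le zero_le_one,
    integral_Ioc_eq_integral_Ioo]
  have : ∫ x in Set.Ioo (0:ℝ) 1, (x : ℂ) ^ (((n : ℝ) : ℂ) - 1) * (1 - (x : ℂ)) ^ (((t + 1 : ℝ) : ℂ) - 1)
      = ((∫ r in Set.Ioo (0:ℝ) 1, r ^ (n - 1) * 1 * (1 - r) ^ t : ℝ) : ℂ) := by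
    rw [← integral_complex_ofReal]
    refine setIntegral_congr_fun measurableSet_Ioo ?_
    intro x hx
    have e1 : (((n : ℝ) : ℂ) - 1) = ((n - 1 : ℕ) : ℂ) := by
      push_cast [Nat.cast_sub hn]; rfl
    have e2 : (((t + 1 : ℝ) : ℂ) - 1) = (t : ℂ) := by push_cast; ring
    simp only [e1, e2, Complex.cpow_natCast]
    push_cast
    rw [Complex.ofReal_cpow (by linarith [hx.2])]
    push_cast
    ring
  rw [this, Complex.ofReal_re]

/-- radial weight -/
noncomputable def Wt (t r : ℝ) : ℝ := if r < 1 then (1 - r ^ 2) ^ t else 0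

lemma Wt_nonneg (t r : ℝ) (hr : 0 ≤ r) : 0 ≤ Wt t r := by
  unfold Wt
  split_ifs with h
  · exact Real.rpow_nonneg (by nlinarith) _
  · exact le_rfl

lemma Wt_meas (t : ℝ) : Measurable (Wt t) := by
  unfold Wt
  exact Measurable.ite measurableSet_Iio (by fun_prop) measurable_const

lemma sq_image : (fun y : ℝ => y ^ 2) '' Set.Ioo 0 1 = Set.Ioo 0 1 := by
  ext x
  constructor
  · rintro ⟨y, ⟨h0, h1⟩, rfl⟩
    exact ⟨by positivity, by simp only; nlinarith⟩
  · rintro ⟨h0, h1⟩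
    refine ⟨Real.sqrt x, ⟨Real.sqrt_pos.2 h0, ?_⟩, Real.sq_sqrt h0.le⟩
    rw [Real.sqrt_lt' one_pos]; simpa using h1

lemma sq_injOn : Set.InjOn (fun y : ℝ => y ^ 2) (Set.Ioo 0 1) := by
  intro x hx y hy h
  exact (pow_left_inj₀ hx.1.le hy.1.le two_ne_zero).1 h

lemma sq_deriv : ∀ x ∈ Set.Ioo (0:ℝ) 1,
    HasDerivWithinAt (fun y : ℝ => y ^ 2) (2 * x) (Set.Ioo 0 1) x := by
  intro x _
  simpa using (hasDerivAt_pow 2 x).hasDerivWithinAt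

lemma sq_integrand (n : ℕ) (hn : 1 ≤ n) (t : ℝ) : ∀ y ∈ Set.Ioo (0:ℝ) 1,
    |2 * y| • ((y ^ 2) ^ (n - 1) * 1 * (1 - y ^ 2) ^ t) = 2 * (y ^ (2 * n - 1) • Wt t y) := by
  intro y hy
  obtain ⟨k, rfl⟩ : ∃ k, n = k + 1 := ⟨n - 1, by omega⟩
  rw [abs_of_pos (by linarith [hy.1]), Wt, if_pos hy.2]
  rw [show 2 * (k + 1) - 1 = 2 * k + 1 by omega, Nat.add_sub_cancel]
  simp only [smul_eq_mul]
  ring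

lemma radial_integrable (n : ℕ) (hn : 1 ≤ n) (t : ℝ) (ht : -1 < t) :
    IntegrableOn (fun y : ℝ => y ^ (2 * n - 1) • Wt t y) (Set.Ioi 0) := by
  have h := aux_int2 t ht (n - 1) 0 le_rfl one_pos
  rw [← sq_image, integrableOn_image_iff_integrableOn_abs_deriv_smul measurableSet_Ioo
    sq_deriv sq_injOn, integrableOn_congr_fun (sq_integrand n hn t) measurableSet_Ioo] at h
  have h2 := h.const_mul (1 / 2)
  have h3 : IntegrableOn (fun y : ℝ => y ^ (2 * n - 1) • Wt t y) (Set.Ioo 0 1) := by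
    refine h2.congr (Filter.Eventually.of_forall fun y => ?_)
    simp only; ring
  refine (IntegrableOn.of_forall_sdiff_eq_zero h3 measurableSet_Ioi ?_)
  rintro x ⟨hx, hx'⟩
  have : ¬ x < 1 := fun h => hx' ⟨hx, h⟩
  simp [Wt, this]

lemma radial_integral (n : ℕ) (hn : 1 ≤ n) (t : ℝ) :
    ∫ y in Set.Ioi (0:ℝ), y ^ (2 * n - 1) • Wt t y = Ft t n (fun _ => 1) 0 / 2 := by
  have h := integral_image_eq_integral_abs_deriv_smul measurableSet_Ioo
    sq_deriv sq_injOn (fun r : ℝ => r ^ (n - 1) * 1 * (1 - r) ^ t)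
  rw [sq_image, setIntegral_congr_fun measurableSet_Ioo (sq_integrand n hn t),
    integral_const_mul] at h
  rw [Ft, h, mul_div_cancel_left₀ _ two_ne_zero]
  refine setIntegral_eq_of_subset_of_forall_sdiff_eq_zero measurableSet_Ioi
    Set.Ioo_subset_Ioi_self ?_
  rintro x ⟨hx, hx'⟩
  have : ¬ x < 1 := fun h => hx' ⟨hx, h⟩
  simp [Wt, this]

lemma kernel_integral (n : ℕ) (hn : 1 ≤ n) (t : ℝ) (a : ℝ) (ha0 : 0 < a) (ha1 : a < 1) :
    ∫ ρ in Set.Ioo (0:ℝ) 1, (ρ ^ (2 * n + 1))⁻¹ * Wt t (a / ρ)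
      = Ft t n (fun _ => 1) (a ^ 2) / (2 * a ^ (2 * n)) := by
  have e1 : ∫ ρ in Set.Ioo (0:ℝ) 1, (ρ ^ (2 * n + 1))⁻¹ * Wt t (a / ρ)
      = ∫ ρ in Set.Ioo a 1, (ρ ^ (2 * n + 1))⁻¹ * Wt t (a / ρ) := by
    refine setIntegral_eq_of_subset_of_forall_sdiff_eq_zero measurableSet_Ioo
      (Set.Ioo_subset_Ioo_left ha0.le) ?_
    rintro x ⟨hx, hx'⟩
    have : ¬ a / x < 1 := fun h => hx' ⟨by rwa [div_lt_one hx.1] at h, hx.2⟩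
    simp [Wt, this]
  have im : (fun ρ : ℝ => a ^ 2 / ρ ^ 2) '' Set.Ioo a 1 = Set.Ioo (a ^ 2) 1 := by
    ext x
    constructor
    · rintro ⟨y, ⟨h0, h1⟩, rfl⟩
      have hy : 0 < y := ha0.trans h0
      constructor
      · simp only
        rw [lt_div_iff₀ (by positivity)]
        have : y ^ 2 < 1 := by nlinarith
        have : 0 < a ^ 2 := by positivity
        nlinarith
      · simp only
        rw [div_lt_one (by positivity)]; nlinarith
    · rintro ⟨h0, h1⟩
      have hx0 : 0 < x := lt_trans (by positivity) h0
      have hs : 0 < Real.sqrt x := Real.sqrt_pos.2 hx0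
      have hs2 := Real.sq_sqrt hx0.le
      refine ⟨a / Real.sqrt x, ⟨?_, ?_⟩, ?_⟩
      · rw [lt_div_iff₀ hs]
        have : Real.sqrt x < 1 := by nlinarith
        nlinarith
      · rw [div_lt_one hs]
        nlinarith
      · simp only [div_pow, hs2]
        field_simp
  have inj : Set.InjOn (fun ρ : ℝ => a ^ 2 / ρ ^ 2) (Set.Ioo a 1) := by
    intro x hx y hy h
    have hx0 := ha0.trans hx.1
    have hy0 := ha0.trans hy.1
    simp only at h
    rw [div_eq_div_iff (by positivity) (by positivity)] at h
    have := mul_left_cancel₀ (by positivity) h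
    exact ((pow_left_inj₀ hy0.le hx0.le two_ne_zero).1 this).symm
  have der : ∀ x ∈ Set.Ioo a 1,
      HasDerivWithinAt (fun ρ : ℝ => a ^ 2 / ρ ^ 2) (-(2 * a ^ 2 / x ^ 3)) (Set.Ioo a 1) x := by
    intro x hx
    have hx0 := ha0.trans hx.1
    have := ((hasDerivAt_const x (a ^ 2)).div (hasDerivAt_pow 2 x) (by positivity)).hasDerivWithinAt
      (s := Set.Ioo a 1)
    refine this.congr_deriv ?_
    have hx1 : x ≠ 0 := hx0.ne'
    simp only [Nat.cast_ofNat, Nat.add_one_sub_one, pow_one]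
    field_simp
    ring
  rw [e1, Ft, ← im, integral_image_eq_integral_abs_deriv_smul measurableSet_Ioo der inj,
    ← integral_div]
  refine setIntegral_congr_fun measurableSet_Ioo ?_
  intro x hx
  have hx0 := ha0.trans hx.1
  have : a / x < 1 := by rw [div_lt_one hx0]; exact hx.1
  obtain ⟨k, rfl⟩ : ∃ k, n = k + 1 := ⟨n - 1, by omega⟩
  simp only [Wt, if_pos this, abs_neg, smul_eq_mul, Nat.add_sub_cancel]
  rw [abs_of_pos (by positivity)]
  rw [div_pow a x 2]
  generalize (1 - a ^ 2 / x ^ 2) ^ t = q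
  rw [div_pow]
  field_simp
  ring

section generic
variable {E : Type*} [NormedAddCommGroup E] [NormedSpace ℝ E] [FiniteDimensional ℝ E]
  [Nontrivial E] [MeasurableSpace E] [BorelSpace E]

lemma weight_integrable (μ : Measure E) [μ.IsAddHaarMeasure] (n : ℕ) (hn : 1 ≤ n) (t : ℝ)
    (ht : -1 < t) (hd : Module.finrank ℝ E = 2 * n) :
    Integrable (fun z : E => Wt t ‖z‖) μ := by
  rw [integrable_fun_norm_addHaar μ (f := Wt t), hd]
  exact radial_integrable n hn t ht

lemma weight_integral (μ : Measure E) [μ.IsAddHaarMeasure] (n : ℕ) (hn : 1 ≤ n) (t : ℝ)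
    (hd : Module.finrank ℝ E = 2 * n) :
    ∫ z : E, Wt t ‖z‖ ∂μ = n * μ.real (Metric.ball 0 1) * Ft t n (fun _ => 1) 0 := by
  rw [integral_fun_norm_addHaar μ (Wt t), hd, radial_integral n hn t]
  simp only [nsmul_eq_mul, smul_eq_mul]
  push_cast
  ring

lemma weighted_integrable {μ : Measure E} {t : ℝ}
    (hW : Integrable (fun z : E => Wt t ‖z‖) μ) (g : E → ℂ) (hg : Continuous g) (M : ℝ)
    (hM : ∀ z, ‖z‖ ≤ 1 → ‖g z‖ ≤ M) :
    Integrable (fun z => Wt t ‖z‖ • g z) μ ∧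
      ∀ z, ‖Wt t ‖z‖ • g z‖ ≤ M * Wt t ‖z‖ := by
  have key : ∀ z, ‖Wt t ‖z‖ • g z‖ ≤ M * Wt t ‖z‖ := by
    intro z
    rw [norm_smul, Real.norm_of_nonneg (Wt_nonneg t _ (norm_nonneg z)), mul_comm]
    by_cases h : ‖z‖ < 1
    · exact mul_le_mul_of_nonneg_right (hM z h.le) (Wt_nonneg t _ (norm_nonneg z))
    · simp [Wt, h]
  refine ⟨(hW.const_mul M).mono' ?_ (Filter.Eventually.of_forall key), key⟩
  exact (((Wt_meas t).comp measurable_norm).aestronglyMeasurable).smul hg.aestronglyMeasurable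

lemma scaled_eq (n : ℕ) (t : ℝ) (L : E → ℂ) (ρ : ℝ) (hρ : 0 < ρ) (w : E) :
    ((ρ ^ (2 * n + 1))⁻¹ * Wt t (‖w‖ / ρ)) • L w
      = (ρ ^ (2 * n))⁻¹ • (fun z => Wt t ‖z‖ • (ρ⁻¹ • L (ρ • z))) (ρ⁻¹ • w) := by
  simp only [norm_smul, norm_inv, Real.norm_of_nonneg hρ.le, smul_smul]
  rw [mul_inv_cancel₀ hρ.ne', one_smul, div_eq_inv_mul]
  congr 1
  rw [pow_succ, mul_inv]
  ring

lemma scaled_bound (L : E → ℂ) (M : ℝ)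
    (hM : ∀ z, ‖z‖ ≤ 1 → ‖L z‖ ≤ M * ‖z‖) (hM0 : 0 ≤ M) (ρ : ℝ) (hρ : 0 < ρ) (hρ1 : ρ < 1) (z : E)
    (hz : ‖z‖ ≤ 1) : ‖ρ⁻¹ • L (ρ • z)‖ ≤ M := by
  have h1 : ‖ρ • z‖ = ρ * ‖z‖ := by rw [norm_smul, Real.norm_of_nonneg hρ.le]
  have h2 : ‖L (ρ • z)‖ ≤ M * (ρ * ‖z‖) := by
    rw [← h1]; apply hM; rw [h1]; nlinarith [norm_nonneg z]
  rw [norm_smul, norm_inv, Real.norm_of_nonneg hρ.le, inv_mul_le_iff₀ hρ]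
  have : M * (ρ * ‖z‖) ≤ M * (ρ * 1) := by gcongr
  linarith

lemma scaled_integrable (μ : Measure E) [μ.IsAddHaarMeasure] (n : ℕ) (t : ℝ)
    (hd : Module.finrank ℝ E = 2 * n) (hW : Integrable (fun z : E => Wt t ‖z‖) μ)
    (L : E → ℂ) (hL : Continuous L) (M : ℝ) (hM0 : 0 ≤ M)
    (hM : ∀ z, ‖z‖ ≤ 1 → ‖L z‖ ≤ M * ‖z‖) :
    Integrable (Function.uncurry fun (w : E) (ρ : ℝ) =>
      ((ρ ^ (2 * n + 1))⁻¹ * Wt t (‖w‖ / ρ)) • L w)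
      (μ.prod (volume.restrict (Set.Ioo (0:ℝ) 1))) := by
  have hmeas : AEStronglyMeasurable (Function.uncurry fun (w : E) (ρ : ℝ) =>
      ((ρ ^ (2 * n + 1))⁻¹ * Wt t (‖w‖ / ρ)) • L w)
      (μ.prod (volume.restrict (Set.Ioo (0:ℝ) 1))) := by
    refine Measurable.aestronglyMeasurable ?_
    refine Measurable.smul (Measurable.mul (by fun_prop) ((Wt_meas t).comp (by fun_prop))) ?_
    exact hL.measurable.comp measurable_fst
  have hB : ∀ ρ ∈ Set.Ioo (0:ℝ) 1, _ := fun ρ hρ => weighted_integrable hW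
    (fun z => ρ⁻¹ • L (ρ • z)) (by fun_prop) M
    (fun z hz => scaled_bound L M hM hM0 ρ hρ.1 hρ.2 z hz)
  rw [integrable_prod_iff' hmeas]
  constructor
  · filter_upwards [self_mem_ae_restrict measurableSet_Ioo] with ρ hρ
    simp only [Function.uncurry]
    simp_rw [scaled_eq n t L ρ hρ.1]
    exact ((hB ρ hρ).1.comp_smul (inv_ne_zero hρ.1.ne')).smul ((ρ ^ (2 * n))⁻¹)
  · refine (integrable_const (M * ∫ z, Wt t ‖z‖ ∂μ)).mono' ?_ ?_
    · exact (hmeas.norm.prod_swap.integral_prod_right' :)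
    · filter_upwards [self_mem_ae_restrict measurableSet_Ioo] with ρ hρ
      simp only [Function.uncurry]
      simp_rw [scaled_eq n t L ρ hρ.1]
      rw [Real.norm_of_nonneg (integral_nonneg fun _ => norm_nonneg _)]
      simp_rw [norm_smul ((ρ ^ (2 * n))⁻¹)]
      rw [integral_const_mul, Measure.integral_comp_smul μ
        (fun z => ‖(fun z => Wt t ‖z‖ • (ρ⁻¹ • L (ρ • z))) z‖) ρ⁻¹, hd, ← integral_const_mul]
      have hp : 0 < ρ ^ (2 * n) := pow_pos hρ.1 _
      rw [norm_inv, Real.norm_of_nonneg hp.le, inv_pow, inv_inv, abs_of_pos hp, smul_eq_mul,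
        inv_mul_cancel_left₀ hp.ne']
      exact integral_mono (hB ρ hρ).1.norm (hW.const_mul M) (hB ρ hρ).2

lemma scaled_formula (μ : Measure E) [μ.IsAddHaarMeasure] (n : ℕ) (t : ℝ)
    (hd : Module.finrank ℝ E = 2 * n) (hW : Integrable (fun z : E => Wt t ‖z‖) μ)
    (L : E → ℂ) (hL : Continuous L) (M : ℝ) (hM0 : 0 ≤ M)
    (hM : ∀ z, ‖z‖ ≤ 1 → ‖L z‖ ≤ M * ‖z‖) :
    ∫ w, (∫ ρ in Set.Ioo (0:ℝ) 1, (ρ ^ (2 * n + 1))⁻¹ * Wt t (‖w‖ / ρ)) • L w ∂μ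
      = ∫ ρ in Set.Ioo (0:ℝ) 1, ∫ z, Wt t ‖z‖ • (ρ⁻¹ • L (ρ • z)) ∂μ := by
  have h := integral_integral_swap (scaled_integrable μ n t hd hW L hL M hM0 hM)
  simp_rw [integral_smul_const] at h
  rw [h]
  refine setIntegral_congr_fun measurableSet_Ioo ?_
  intro ρ hρ
  simp only
  simp_rw [scaled_eq n t L ρ hρ.1]
  rw [integral_smul, Measure.integral_comp_smul μ
        (fun z => Wt t ‖z‖ • (ρ⁻¹ • L (ρ • z))) ρ⁻¹, hd]
  have hp : 0 < ρ ^ (2 * n) := pow_pos hρ.1 _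
  rw [inv_pow, inv_inv, abs_of_pos hp, smul_smul, inv_mul_cancel₀ hp.ne', one_smul]

lemma rot_zero (μ : Measure E) (t : ℝ)
    (hW : Integrable (fun z : E => Wt t ‖z‖) μ)
    (Rot : ℝ → E ≃ₗᵢ[ℝ] E) (hR : ∀ θ, MeasurePreserving (Rot θ) μ μ) (J : E →L[ℝ] E)
    (hJ : ∀ z, ‖J z‖ = ‖z‖) (hR0 : ∀ z, Rot 0 z = z)
    (hRd : ∀ θ z, HasDerivAt (fun θ => Rot θ z) (J (Rot θ z)) θ)
    (v : E → ℂ) (hv : ContDiff ℝ 1 v) (M : ℝ) (hM0 : 0 ≤ M)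
    (hM : ∀ z, ‖z‖ ≤ 1 → ‖fderiv ℝ v z‖ ≤ M) (ρ : ℝ) (hρ : ρ ∈ Set.Ioo (0:ℝ) 1) :
    ∫ z, Wt t ‖z‖ • fderiv ℝ v (ρ • z) (J z) ∂μ = 0 := by
  have hfc : Continuous (fderiv ℝ v) := hv.continuous_fderiv one_ne_zero
  have hsm : ∀ z : E, ‖z‖ ≤ 1 → ‖ρ • z‖ ≤ 1 := by
    intro z hz
    rw [norm_smul, Real.norm_of_nonneg hρ.1.le]; nlinarith [hρ.1, hρ.2, norm_nonneg z]
  obtain ⟨M', hM'⟩ := (isCompact_closedBall (0:E) 1).exists_bound_of_continuousOn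
    hv.continuous.continuousOn
  have hcont : ∀ θ, Continuous (Rot θ) := fun θ => (Rot θ).continuous
  have hWm : AEStronglyMeasurable (fun z : E => Wt t ‖z‖) μ := hW.1
  have main := hasDerivAt_integral_of_dominated_loc_of_deriv_le (μ := μ) (x₀ := (0:ℝ))
    (s := Set.univ) (bound := fun z => M * Wt t ‖z‖)
    (F := fun θ z => Wt t ‖z‖ • v (ρ • Rot θ z))
    (F' := fun θ z => Wt t ‖z‖ • fderiv ℝ v (ρ • Rot θ z) (ρ • J (Rot θ z)))
    Filter.univ_mem
    (Filter.Eventually.of_forall fun θ => hWm.smul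
      (Continuous.aestronglyMeasurable (hv.continuous.comp ((hcont θ).const_smul ρ))))
    (weighted_integrable hW (fun z => v (ρ • Rot 0 z))
      (hv.continuous.comp ((hcont 0).const_smul ρ)) M' (fun z hz => hM' _ (by
        rw [mem_closedBall_zero_iff]
        apply hsm; rw [(Rot 0).norm_map]; exact hz))).1
    (hWm.smul (Continuous.aestronglyMeasurable
      ((hfc.comp ((hcont 0).const_smul ρ)).clm_apply
        ((J.continuous.comp (hcont 0)).const_smul ρ))))
    (Filter.Eventually.of_forall fun z θ _ => by
      refine (weighted_integrable hW (fun z => fderiv ℝ v (ρ • Rot θ z) (ρ • J (Rot θ z)))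
        ((hfc.comp ((hcont θ).const_smul ρ)).clm_apply
        ((J.continuous.comp (hcont θ)).const_smul ρ)) M ?_).2 z
      intro z hz
      refine (ContinuousLinearMap.le_opNorm _ _).trans ?_
      have h1 : ‖ρ • J (Rot θ z)‖ ≤ 1 := by
        have := hsm (J (Rot θ z)) (by rw [hJ, (Rot θ).norm_map]; exact hz)
        exact this
      have h2 := hM (ρ • Rot θ z) (hsm _ (by rw [(Rot θ).norm_map]; exact hz))
      calc _ ≤ M * 1 := by gcongr
        _ = M := mul_one M)
    (hW.const_mul M)
    (Filter.Eventually.of_forall fun z θ _ => by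
      have h1 : HasDerivAt (fun θ => ρ • Rot θ z) (ρ • J (Rot θ z)) θ := (hRd θ z).const_smul ρ
      have h2 : HasFDerivAt v (fderiv ℝ v (ρ • Rot θ z)) (ρ • Rot θ z) :=
        ((hv.differentiable one_ne_zero) _).hasFDerivAt
      exact (h2.comp_hasDerivAt θ h1).const_smul (Wt t ‖z‖))
  have hconst : (fun θ => ∫ z, Wt t ‖z‖ • v (ρ • Rot θ z) ∂μ)
      = fun _ => ∫ z, Wt t ‖z‖ • v (ρ • z) ∂μ := by
    funext θ
    have := (hR θ).integral_comp (Rot θ).toHomeomorph.measurableEmbedding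
      (fun z => Wt t ‖z‖ • v (ρ • z))
    simp only [(Rot θ).norm_map] at this
    exact this
  have h2 := main.2
  rw [hconst] at h2
  have h3 := h2.unique (hasDerivAt_const _ _)
  simp only [hR0, map_smul, smul_comm _ ρ] at h3
  rw [integral_smul] at h3
  exact (smul_eq_zero.1 h3).resolve_left hρ.1.ne'

lemma ftc_part (μ : Measure E) [SFinite μ] (t : ℝ)
    (hW : Integrable (fun z : E => Wt t ‖z‖) μ)
    (v : E → ℂ) (hv : ContDiff ℝ 1 v) (M : ℝ)
    (hM : ∀ z, ‖z‖ ≤ 1 → ‖fderiv ℝ v z‖ ≤ M) (hM0 : 0 ≤ M) :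
    ∫ ρ in Set.Ioo (0:ℝ) 1, ∫ z, Wt t ‖z‖ • fderiv ℝ v (ρ • z) z ∂μ
      = ∫ z, Wt t ‖z‖ • (v z - v 0) ∂μ := by
  have hfc : Continuous (fderiv ℝ v) := hv.continuous_fderiv one_ne_zero
  have hint : Integrable (Function.uncurry fun (z : E) (ρ : ℝ) =>
      Wt t ‖z‖ • fderiv ℝ v (ρ • z) z) (μ.prod (volume.restrict (Set.Ioo (0:ℝ) 1))) := by
    have hb : Integrable (fun p : E × ℝ => (M * Wt t ‖p.1‖) * 1)
        (μ.prod (volume.restrict (Set.Ioo (0:ℝ) 1))) :=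
      (hW.const_mul M).mul_prod (integrable_const (1:ℝ))
    refine hb.mono' ?_ ?_
    · refine Measurable.aestronglyMeasurable ?_
      refine Measurable.smul ((Wt_meas t).comp (by fun_prop)) ?_
      exact Continuous.measurable ((hfc.comp (by fun_prop)).clm_apply continuous_fst)
    · have : ∀ᵐ p ∂(μ.prod (volume.restrict (Set.Ioo (0:ℝ) 1))), p.2 ∈ Set.Ioo (0:ℝ) 1 :=
        Measure.quasiMeasurePreserving_snd.ae (self_mem_ae_restrict measurableSet_Ioo)
      filter_upwards [this] with p hp
      simp only [Function.uncurry, mul_one]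
      rw [norm_smul, Real.norm_of_nonneg (Wt_nonneg t _ (norm_nonneg _)), mul_comm]
      by_cases h : ‖p.1‖ < 1
      · refine mul_le_mul_of_nonneg_right ?_ (Wt_nonneg t _ (norm_nonneg _))
        refine (ContinuousLinearMap.le_opNorm _ _).trans ?_
        have h2 := hM (p.2 • p.1) (by
          rw [norm_smul, Real.norm_of_nonneg hp.1.le]
          nlinarith [hp.1, hp.2, norm_nonneg p.1])
        calc _ ≤ M * 1 := by gcongr
          _ = M := mul_one M
      · simp [Wt, h]
  rw [← integral_integral_swap hint]
  refine integral_congr_ae (Filter.Eventually.of_forall fun z => ?_)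
  simp only
  rw [integral_smul]
  congr 1
  rw [← integral_Ioc_eq_integral_Ioo, ← intervalIntegral.integral_of_le zero_le_one,
    intervalIntegral.integral_eq_sub_of_hasDerivAt (f := fun ρ : ℝ => v (ρ • z))]
  · simp
  · intro ρ _
    have h1 : HasDerivAt (fun ρ : ℝ => ρ • z) z ρ := by
      simpa using (hasDerivAt_id ρ).smul_const z
    have h2 : HasFDerivAt v (fderiv ℝ v (ρ • z)) (ρ • z) :=
        ((hv.differentiable one_ne_zero) _).hasFDerivAt
    exact h2.comp_hasDerivAt ρ h1
  · refine Continuous.intervalIntegrable ?_ _ _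
    exact (hfc.comp (by fun_prop)).clm_apply continuous_const

lemma main_generic (μ : Measure E) [μ.IsAddHaarMeasure] (n : ℕ) (t : ℝ)
    (hd : Module.finrank ℝ E = 2 * n) (hW : Integrable (fun z : E => Wt t ‖z‖) μ)
    (Rot : ℝ → E ≃ₗᵢ[ℝ] E) (hR : ∀ θ, MeasurePreserving (Rot θ) μ μ) (J : E →L[ℝ] E)
    (hJ : ∀ z, ‖J z‖ = ‖z‖) (hR0 : ∀ z, Rot 0 z = z)
    (hRd : ∀ θ z, HasDerivAt (fun θ => Rot θ z) (J (Rot θ z)) θ)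
    (v : E → ℂ) (hv : ContDiff ℝ 1 v) :
    ∫ w, (∫ ρ in Set.Ioo (0:ℝ) 1, (ρ ^ (2 * n + 1))⁻¹ * Wt t (‖w‖ / ρ)) •
        (fderiv ℝ v w w + Complex.I * fderiv ℝ v w (J w)) ∂μ
      = ∫ z, Wt t ‖z‖ • (v z - v 0) ∂μ := by
  have hfc : Continuous (fderiv ℝ v) := hv.continuous_fderiv one_ne_zero
  obtain ⟨M, hM'⟩ := (isCompact_closedBall (0:E) 1).exists_bound_of_continuousOn
    hfc.continuousOn
  have hM : ∀ z, ‖z‖ ≤ 1 → ‖fderiv ℝ v z‖ ≤ M := fun z hz =>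
    hM' z (by rwa [mem_closedBall_zero_iff])
  have hM0 : 0 ≤ M := (norm_nonneg _).trans (hM 0 (by simp))
  have hc1 : Continuous fun z => fderiv ℝ v z (J z) := hfc.clm_apply J.continuous
  have hc2 : Continuous fun z => fderiv ℝ v z z := hfc.clm_apply continuous_id
  rw [scaled_formula μ n t hd hW _ (by fun_prop) (M + M) (by positivity), ← ftc_part μ t hW v hv M hM hM0]
  · refine setIntegral_congr_fun measurableSet_Ioo ?_
    intro ρ hρ
    simp only
    have hz := rot_zero μ t hW Rot hR J hJ hR0 hRd v hv M hM0 hM ρ hρ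
    have hsm : ∀ z : E, ‖z‖ ≤ 1 → ‖ρ • z‖ ≤ 1 := by
      intro z hz
      rw [norm_smul, Real.norm_of_nonneg hρ.1.le]; nlinarith [hρ.1, hρ.2, norm_nonneg z]
    have e : ∀ z, Wt t ‖z‖ • (ρ⁻¹ • (fderiv ℝ v (ρ • z) (ρ • z)
        + Complex.I * fderiv ℝ v (ρ • z) (J (ρ • z))))
        = Wt t ‖z‖ • fderiv ℝ v (ρ • z) z
          + Complex.I * (Wt t ‖z‖ • fderiv ℝ v (ρ • z) (J z)) := by
      intro z
      have : ρ ≠ 0 := hρ.1.ne'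
      simp only [map_smul, mul_smul_comm, ← smul_add, smul_smul]
      rw [inv_mul_cancel₀ this, mul_one]
    simp_rw [e]
    have hbd : ∀ w z : E, ‖z‖ ≤ 1 → ‖w‖ = ‖z‖ → ‖fderiv ℝ v (ρ • z) w‖ ≤ M := by
      intro w z hz hwz
      refine (ContinuousLinearMap.le_opNorm _ _).trans ?_
      have h2 := hM (ρ • z) (hsm z hz)
      calc _ ≤ M * 1 := by gcongr; linarith
          _ = M := mul_one M
    rw [integral_add, integral_const_mul, hz, mul_zero, add_zero]
    · exact (weighted_integrable hW _ ((hfc.comp (by fun_prop)).clm_apply continuous_id) M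
        (fun z hz => hbd z z hz rfl)).1
    · exact ((weighted_integrable hW _ ((hfc.comp (by fun_prop)).clm_apply J.continuous) M
        (fun z hz => hbd (J z) z hz (hJ z))).1).const_mul _
  · intro z hz
    refine (norm_add_le _ _).trans ?_
    rw [norm_mul, Complex.norm_I, one_mul, add_mul]
    refine add_le_add ?_ ?_
    · exact (ContinuousLinearMap.le_opNorm _ _).trans (by gcongr; exact hM z hz)
    · refine (ContinuousLinearMap.le_opNorm _ _).trans ?_
      rw [hJ]; gcongr; exact hM z hz

end generic

/-- multiplication by a unimodular constant -/
noncomputable def rotE (n : ℕ) (c : ℂ) (hc : ‖c‖ = 1) :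
    EuclideanSpace ℂ (Fin n) ≃ₗᵢ[ℝ] EuclideanSpace ℂ (Fin n) where
  toFun z := c • z
  invFun z := c⁻¹ • z
  map_add' x y := smul_add c x y
  map_smul' r x := smul_comm c r x
  left_inv x := inv_smul_smul₀ (by rintro rfl; simp at hc) x
  right_inv x := smul_inv_smul₀ (by rintro rfl; simp at hc) x
  norm_map' x := by
    change ‖c • x‖ = ‖x‖
    rw [norm_smul, hc, one_mul]

lemma rotE_apply (n : ℕ) (c : ℂ) (hc : ‖c‖ = 1) (z : EuclideanSpace ℂ (Fin n)) :
    rotE n c hc z = c • z := rfl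

lemma Rbar_eq {n : ℕ} (v : EuclideanSpace ℂ (Fin n) → ℂ) (z : EuclideanSpace ℂ (Fin n)) :
    Rbar v z = (1 / 2 : ℂ) * (fderiv ℝ v z z + Complex.I * fderiv ℝ v z (Complex.I • z)) := by
  have h1 : z = ∑ j, ((z j).re • EuclideanSpace.single j (1:ℂ)
      + (z j).im • EuclideanSpace.single j Complex.I) := by
    ext i
    simp [Finset.sum_apply, Pi.single_apply, Finset.sum_add_distrib, Complex.re_add_im]
  have h2 : Complex.I • z = ∑ j, ((z j).re • EuclideanSpace.single j Complex.I
      - (z j).im • EuclideanSpace.single j (1:ℂ)) := by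
    ext i
    simp [Finset.sum_apply, Pi.single_apply, Finset.sum_sub_distrib]
    conv_lhs => rw [← Complex.re_add_im (z i)]
    ring_nf
    simp
    ring
  have e1 : fderiv ℝ v z z = ∑ j, (((z j).re : ℂ) * fderiv ℝ v z (EuclideanSpace.single j (1:ℂ))
      + ((z j).im : ℂ) * fderiv ℝ v z (EuclideanSpace.single j Complex.I)) := by
    generalize fderiv ℝ v z = D
    conv_lhs => rw [h1]
    simp only [map_sum, map_add, map_smul, Complex.real_smul]
  have e2 : fderiv ℝ v z (Complex.I • z) =
      ∑ j, (((z j).re : ℂ) * fderiv ℝ v z (EuclideanSpace.single j Complex.I)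
      - ((z j).im : ℂ) * fderiv ℝ v z (EuclideanSpace.single j (1:ℂ))) := by
    rw [h2]
    simp only [map_sum, map_sub, map_smul, Complex.real_smul]
  rw [e1, e2, Rbar, Finset.mul_sum, ← Finset.sum_add_distrib, Finset.mul_sum]
  refine Finset.sum_congr rfl fun j _ => ?_
  have hc : (starRingEnd ℂ) (z j) = (z j).re - (z j).im * Complex.I := by
    apply Complex.ext <;> simp
  rw [hc, wdbar]
  linear_combination (-(1 / 2 : ℂ) * (z j).im * fderiv ℝ v z (EuclideanSpace.single j Complex.I)) * Complex.I_sq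

/-- normalising constant -/
noncomputable def cst (n : ℕ) (t : ℝ) : ℝ :=
  (Nat.factorial (n - 1) : ℝ) / (Real.pi ^ n * Bfun n (t + 1))

lemma Bfun_pos (n : ℕ) (hn : 1 ≤ n) (t : ℝ) (ht : -1 < t) : 0 < Bfun n (t + 1) :=
  ProbabilityTheory.beta_pos (by exact_mod_cast hn) (by linarith)

lemma cst_pos (n : ℕ) (hn : 1 ≤ n) (t : ℝ) (ht : -1 < t) : 0 < cst n t := by
  have := Bfun_pos n hn t ht
  unfold cst
  positivity

lemma cst_succ (n : ℕ) (hn : 1 ≤ n) (t : ℝ) (ht : -1 < t) :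
    (t + 1) / ((n : ℝ) + t + 1) * cst n (t + 1) = cst n t := by
  have hn' : (0 : ℝ) < n := by exact_mod_cast hn
  have h1 : 0 < t + 1 := by linarith
  unfold cst Bfun
  rw [← add_assoc (n : ℝ) (t + 1) 1, Real.Gamma_add_one h1.ne',
    Real.Gamma_add_one (s := (n : ℝ) + (t + 1)) (by linarith)]
  have := Real.Gamma_pos_of_pos hn'
  have := Real.Gamma_pos_of_pos h1
  have := Real.Gamma_pos_of_pos (show 0 < (n : ℝ) + (t + 1) by linarith)
  have : 0 < (n : ℝ) + t + 1 := by linarith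
  rw [← add_assoc] at *
  field_simp

lemma lambda_integral (n : ℕ) (hn : 1 ≤ n) (t : ℝ) (ht : -1 < t)
    (f : EuclideanSpace ℂ (Fin n) → ℂ) :
    ∫ z, f z ∂(lambdaMeasure n t) = cst n t • ∫ z, Wt t ‖z‖ • f z := by
  unfold lambdaMeasure
  rw [integral_withDensity_eq_integral_toReal_smul (by fun_prop)
    (Filter.Eventually.of_forall fun _ => ENNReal.ofReal_lt_top), ← integral_smul]
  rw [← setIntegral_eq_integral_of_forall_compl_eq_zero
    (s := Metric.ball (0 : EuclideanSpace ℂ (Fin n)) 1)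
    (f := fun z => cst n t • Wt t ‖z‖ • f z)]
  · refine setIntegral_congr_fun Metric.isOpen_ball.measurableSet ?_
    intro z hz
    rw [mem_ball_zero_iff] at hz
    simp only
    rw [ENNReal.toReal_ofReal, smul_smul, Wt, if_pos hz, cst]
    have := cst_pos n hn t ht
    exact mul_nonneg this.le (Real.rpow_nonneg (by nlinarith [norm_nonneg z]) _)
  · intro z hz
    rw [mem_ball_zero_iff] at hz
    simp [Wt, hz]

lemma finrank_E (n : ℕ) : Module.finrank ℝ (EuclideanSpace ℂ (Fin n)) = 2 * n := by
  have := finrank_real_of_complex (EuclideanSpace ℂ (Fin n))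
  rw [finrank_euclideanSpace_fin] at this
  exact this

lemma mass_one (n : ℕ) (hn : 1 ≤ n) (t : ℝ) (ht : -1 < t) :
    cst n t * ∫ z : EuclideanSpace ℂ (Fin n), Wt t ‖z‖ = 1 := by
  have : Nonempty (Fin n) := ⟨⟨0, hn⟩⟩
  rw [weight_integral volume n hn t (finrank_E n), Ft_zero n hn t ht, Measure.real,
    InnerProductSpace.volume_ball_of_dim_even (finrank_E n)]
  have hB := Bfun_pos n hn t ht
  obtain ⟨k, rfl⟩ : ∃ k, n = k + 1 := ⟨n - 1, by omega⟩
  rw [ENNReal.ofReal_one, one_pow, one_mul, ENNReal.toReal_ofReal (by positivity), cst]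
  rw [Nat.add_sub_cancel, Nat.factorial_succ]
  have : (0:ℝ) < k.factorial := by positivity
  push_cast at hB ⊢
  field_simp

lemma kernel_point (n : ℕ) (hn : 1 ≤ n) (t : ℝ)
    (v : EuclideanSpace ℂ (Fin n) → ℂ) (z : EuclideanSpace ℂ (Fin n)) :
    Wt (t + 1) ‖z‖ • (Gt t n (fun _ => 1) (‖z‖ ^ 2) • Rbar v z)
      = (∫ ρ in Set.Ioo (0:ℝ) 1, (ρ ^ (2 * n + 1))⁻¹ * Wt t (‖z‖ / ρ)) •
        (fderiv ℝ v z z + Complex.I * fderiv ℝ v z (Complex.I • z)) := by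
  rw [Rbar_eq]
  by_cases hz : z = 0
  · subst hz; simp
  by_cases h1 : ‖z‖ < 1
  · have ha : 0 < ‖z‖ := norm_pos_iff.2 hz
    rw [kernel_integral n hn t ‖z‖ ha h1]
    generalize fderiv ℝ v z z + Complex.I * fderiv ℝ v z (Complex.I • z) = D
    have hp : 0 < (1 - ‖z‖ ^ 2) ^ (t + 1) := Real.rpow_pos_of_pos (by nlinarith) _
    have : (1 / 2 : ℂ) * D = (1 / 2 : ℝ) • D := by rw [Complex.real_smul]; norm_num
    rw [this, smul_smul, smul_smul, Wt, if_pos h1, Gt]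
    congr 1
    rw [pow_mul]
    field_simp
  · have e : ∫ ρ in Set.Ioo (0:ℝ) 1, (ρ ^ (2 * n + 1))⁻¹ * Wt t (‖z‖ / ρ) = 0 := by
      refine setIntegral_eq_zero_of_forall_eq_zero ?_
      intro ρ hρ
      have : ¬ ‖z‖ / ρ < 1 := by
        rw [div_lt_one hρ.1]; intro h; exact h1 (h.trans hρ.2)
      simp [Wt, this]
    rw [e, Wt, if_neg h1, zero_smul, zero_smul]

/-- multiplication by `i` -/
noncomputable def JE (n : ℕ) : EuclideanSpace ℂ (Fin n) →L[ℝ] EuclideanSpace ℂ (Fin n) :=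
  ((rotE n Complex.I Complex.norm_I).toContinuousLinearEquiv : _ →L[ℝ] _)

lemma JE_apply (n : ℕ) (z : EuclideanSpace ℂ (Fin n)) : JE n z = Complex.I • z := rfl

lemma JE_norm (n : ℕ) (z : EuclideanSpace ℂ (Fin n)) : ‖JE n z‖ = ‖z‖ :=
  (rotE n Complex.I Complex.norm_I).norm_map z

lemma rot_deriv (n : ℕ) (hexp : ∀ θ : ℝ, ‖Complex.exp (θ * Complex.I)‖ = 1)
    (θ : ℝ) (z : EuclideanSpace ℂ (Fin n)) :
    HasDerivAt (fun θ : ℝ => rotE n (Complex.exp (θ * Complex.I)) (hexp θ) z)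
      (JE n (rotE n (Complex.exp (θ * Complex.I)) (hexp θ) z)) θ := by
  have h : HasDerivAt (fun θ : ℝ => Complex.exp (θ * Complex.I))
      (Complex.exp (θ * Complex.I) * Complex.I) θ := by
    have h0 : HasDerivAt (fun θ : ℝ => (θ : ℂ) * Complex.I) Complex.I θ := by
      simpa using (Complex.ofRealCLM.hasDerivAt (x := θ)).mul_const Complex.I
    exact h0.cexp
  have h2 := h.smul_const z
  rw [mul_comm, mul_smul] at h2
  simp only [rotE_apply, JE_apply]
  exact h2

lemma part1_global (n : ℕ) (hn : 1 ≤ n) (t : ℝ) (ht : -1 < t)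
    (v : EuclideanSpace ℂ (Fin n) → ℂ) (hv : ContDiff ℝ 1 v) :
    (∫ z, v z ∂(lambdaMeasure n t))
        = v 0 + ((t + 1) / ((n : ℝ) + t + 1)) •
            ∫ z, Gt t n (fun _ => 1) (‖z‖ ^ 2) • Rbar v z ∂(lambdaMeasure n (t + 1)) := by
  have : Nonempty (Fin n) := ⟨⟨0, hn⟩⟩
  have hW : Integrable (fun z : EuclideanSpace ℂ (Fin n) => Wt t ‖z‖) volume :=
    weight_integrable volume n hn t ht (finrank_E n)
  have hexp : ∀ θ : ℝ, ‖Complex.exp (θ * Complex.I)‖ = 1 := Complex.norm_exp_ofReal_mul_I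
  have main : ∫ w, (∫ ρ in Set.Ioo (0:ℝ) 1, (ρ ^ (2 * n + 1))⁻¹ * Wt t (‖w‖ / ρ)) •
        (fderiv ℝ v w w + Complex.I * fderiv ℝ v w (Complex.I • w))
      = ∫ z, Wt t ‖z‖ • (v z - v 0) :=
    main_generic volume n t (finrank_E n) hW
      (fun θ => rotE n (Complex.exp (θ * Complex.I)) (hexp θ))
      (fun θ => LinearIsometryEquiv.measurePreserving _)
      (JE n) (JE_norm n)
      (fun z => by simp [rotE_apply]) (rot_deriv n hexp) v hv
  have e1 : ∫ z, Wt (t + 1) ‖z‖ • (Gt t n (fun _ => 1) (‖z‖ ^ 2) • Rbar v z)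
      = ∫ z, Wt t ‖z‖ • (v z - v 0) := by
    rw [← main]
    exact integral_congr_ae (Filter.Eventually.of_forall fun z => kernel_point n hn t v z)
  obtain ⟨M, hM⟩ := (isCompact_closedBall (0:EuclideanSpace ℂ (Fin n)) 1).exists_bound_of_continuousOn
    hv.continuous.continuousOn
  have hi := (weighted_integrable hW v hv.continuous M
    (fun z hz => hM z (by rwa [mem_closedBall_zero_iff]))).1
  have e2 : ∫ z, Wt t ‖z‖ • (v z - v 0)
      = (∫ z, Wt t ‖z‖ • v z) - (∫ z : EuclideanSpace ℂ (Fin n), Wt t ‖z‖) • v 0 := by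
    simp_rw [smul_sub]
    rw [integral_sub hi (hW.smul_const _), integral_smul_const]
  rw [lambda_integral n hn t ht, lambda_integral n hn (t + 1) (by linarith), e1, e2, smul_smul,
    cst_succ n hn t ht, smul_sub, smul_smul, mass_one n hn t ht, one_smul]
  ring

lemma part1 (n : ℕ) (hn : 1 ≤ n) (t : ℝ) (ht : -1 < t)
    (v : EuclideanSpace ℂ (Fin n) → ℂ) (U : Set (EuclideanSpace ℂ (Fin n))) (hU : IsOpen U)
    (hBU : Metric.closedBall (0 : EuclideanSpace ℂ (Fin n)) 1 ⊆ U) (hv : ContDiffOn ℝ 1 v U) :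
    (∫ z, v z ∂(lambdaMeasure n t))
        = v 0 + ((t + 1) / ((n : ℝ) + t + 1)) •
            ∫ z, Gt t n (fun _ => 1) (‖z‖ ^ 2) • Rbar v z ∂(lambdaMeasure n (t + 1)) := by
  obtain ⟨δ, hδ, hsub⟩ := (isCompact_closedBall (0 : EuclideanSpace ℂ (Fin n)) 1).exists_thickening_subset_open hU hBU
  rw [thickening_closedBall hδ zero_le_one] at hsub
  let χ : ContDiffBump (0 : EuclideanSpace ℂ (Fin n)) := ⟨1, 1 + δ / 2, one_pos, by linarith⟩
  let g : EuclideanSpace ℂ (Fin n) → ℂ := fun z => χ z • v z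
  have hg : ContDiff ℝ 1 g := by
    rw [contDiff_iff_contDiffAt]
    intro x
    by_cases hx : x ∈ U
    · exact χ.contDiffAt.smul (hv.contDiffAt (hU.mem_nhds hx))
    · have hx2 : x ∉ tsupport χ := by
        rw [χ.tsupport_eq]
        intro h
        refine hx (hsub ?_)
        refine Metric.closedBall_subset_ball ?_ h
        change 1 + δ / 2 < δ + 1
        linarith
      have h0 : g =ᶠ[nhds x] fun _ => 0 := by
        filter_upwards [notMem_tsupport_iff_eventuallyEq.1 hx2] with y hy
        simp only [g, hy, Pi.zero_apply, zero_smul]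
      exact contDiffAt_const.congr_of_eventuallyEq h0
  have heq : ∀ z ∈ Metric.ball (0 : EuclideanSpace ℂ (Fin n)) 1, g z = v z := by
    intro z hz
    have : χ z = 1 := χ.one_of_mem_closedBall (Metric.ball_subset_closedBall hz)
    simp only [g, this, one_smul]
  have hR : ∀ z ∈ Metric.ball (0 : EuclideanSpace ℂ (Fin n)) 1, Rbar g z = Rbar v z := by
    intro z hz
    have : g =ᶠ[nhds z] v := by
      filter_upwards [Metric.isOpen_ball.mem_nhds hz] with y hy using heq y hy
    rw [Rbar_eq, Rbar_eq, this.fderiv_eq]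
  have h := part1_global n hn t ht g hg
  rw [heq 0 (Metric.mem_ball_self one_pos)] at h
  rw [lambda_integral n hn t ht, lambda_integral n hn (t + 1) (by linarith)] at h ⊢
  have c1 : ∀ z : EuclideanSpace ℂ (Fin n), Wt t ‖z‖ • g z = Wt t ‖z‖ • v z := by
    intro z
    by_cases h1 : ‖z‖ < 1
    · rw [heq z (mem_ball_zero_iff.2 h1)]
    · simp [Wt, h1]
  have c2 : ∀ z : EuclideanSpace ℂ (Fin n),
      Wt (t + 1) ‖z‖ • (Gt t n (fun _ => 1) (‖z‖ ^ 2) • Rbar g z)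
      = Wt (t + 1) ‖z‖ • (Gt t n (fun _ => 1) (‖z‖ ^ 2) • Rbar v z) := by
    intro z
    by_cases h1 : ‖z‖ < 1
    · rw [hR z (mem_ball_zero_iff.2 h1)]
    · simp [Wt, h1]
  simp_rw [c1, c2] at h
  exact h

/-- Integration by parts on the ball (Lemma 7.3): (1) the radial integration-by-parts
formula; (2) `𝓖^{(t)}_n 1(s) ≈ s^{−n}` near `0` and `𝓖^{(t)}_n 1(s) → 1/(t+1)` as
`s → 1⁻`; (3) `|𝓖^{(t)}_n 1(s) − 1/(t+1)| ≲ 1−s` near `1`. -/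
theorem stmt15 (n : ℕ) (hn : 1 ≤ n) (t : ℝ) (ht : -1 < t) :
    (∀ v : EuclideanSpace ℂ (Fin n) → ℂ,
      (∃ U : Set (EuclideanSpace ℂ (Fin n)), IsOpen U ∧
        Metric.closedBall (0 : EuclideanSpace ℂ (Fin n)) 1 ⊆ U ∧ ContDiffOn ℝ 1 v U) →
      (∫ z, v z ∂(lambdaMeasure n t))
        = v 0 + ((t + 1) / ((n : ℝ) + t + 1)) •
            ∫ z, Gt t n (fun _ => 1) (‖z‖ ^ 2) • Rbar v z ∂(lambdaMeasure n (t + 1))) ∧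
    (∃ ε c₁ c₂ : ℝ, 0 < ε ∧ 0 < c₁ ∧ c₁ ≤ c₂ ∧
      ∀ s ∈ Set.Ioo (0 : ℝ) ε,
        c₁ * s ^ (-(n : ℝ)) ≤ Gt t n (fun _ => 1) s ∧
        Gt t n (fun _ => 1) s ≤ c₂ * s ^ (-(n : ℝ))) ∧
    Filter.Tendsto (fun s => Gt t n (fun _ => 1) s)
      (nhdsWithin 1 (Set.Iio 1)) (nhds (1 / (t + 1))) ∧
    (∃ C δ : ℝ, 0 < C ∧ 0 < δ ∧ ∀ s ∈ Set.Ioo (1 - δ) 1,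
      |Gt t n (fun _ => 1) s - 1 / (t + 1)| ≤ C * (1 - s)) := by
  refine ⟨?_, part2a n hn t ht, part2b n hn t ht, part3 n hn t ht⟩
  rintro v ⟨U, hU, hB, hv⟩
  exact part1 n hn t ht v U hU hB hv
end

section
/- Let n ≥ 1, let l ≥ 0 be an integer, and let α, β ∈ ℕ₀ⁿ be multi-indices with |α| = |β| = l. Then ∫_{ℂⁿ} w^α·conj(w)^β·(1+|w|²)^{−(l+n+1)} dm(w) equals πⁿ·α!/(n+l)! if α = β, and equals 0 if α ≠ β. -/
open MeasureTheory

lemma aux_one (a : ℕ) (t : ℝ) (ht : 0 < t) :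
    ∫ z : ℂ, ‖z‖ ^ (2 * a) * Real.exp (-t * ‖z‖ ^ 2)
      = Real.pi * (a.factorial : ℝ) * (t ^ (a + 1))⁻¹ := by
  have h := Complex.integral_rpow_mul_exp_neg_mul_rpow (p := 2) (q := ((2 * a : ℕ) : ℝ)) (b := t)
    (by norm_num) (lt_of_lt_of_le (by norm_num) (Nat.cast_nonneg _)) ht
  have e1 : (((2 * a : ℕ) : ℝ) + 2) / 2 = (a : ℝ) + 1 := by push_cast; ring
  have e2 : -(((2 * a : ℕ) : ℝ) + 2) / 2 = -((a + 1 : ℕ) : ℝ) := by push_cast; ring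
  rw [e1, e2, Real.rpow_neg ht.le, Real.rpow_natCast, Real.Gamma_nat_eq_factorial] at h
  simp only [Real.rpow_natCast, Real.rpow_two] at h
  rw [h]; ring

lemma aux_one_int (a : ℕ) (t : ℝ) (ht : 0 < t) :
    Integrable (fun z : ℂ => ‖z‖ ^ (2 * a) * Real.exp (-t * ‖z‖ ^ 2)) := by
  apply Integrable.of_integral_ne_zero
  rw [aux_one a t ht]
  have := Real.pi_pos
  positivity

lemma aux_prod_eq (n : ℕ) (α : Fin n → ℕ) (t : ℝ) (x : Fin n → ℂ) :
    (∏ j, ‖x j‖ ^ (2 * α j)) * Real.exp (-t * ∑ j, ‖x j‖ ^ 2)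
      = ∏ j, (‖x j‖ ^ (2 * α j) * Real.exp (-t * ‖x j‖ ^ 2)) := by
  rw [Finset.prod_mul_distrib, Finset.mul_sum, Real.exp_sum]

lemma aux_n_int (n : ℕ) (α : Fin n → ℕ) (t : ℝ) (ht : 0 < t) :
    Integrable (fun x : Fin n → ℂ =>
      (∏ j, ‖x j‖ ^ (2 * α j)) * Real.exp (-t * ∑ j, ‖x j‖ ^ 2)) := by
  simp_rw [aux_prod_eq]
  exact Integrable.fintype_prod (f := fun j (z : ℂ) => ‖z‖ ^ (2 * α j) * Real.exp (-t * ‖z‖ ^ 2))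
    (fun i => aux_one_int (α i) t ht)

lemma aux_n (n : ℕ) (α : Fin n → ℕ) (t : ℝ) (ht : 0 < t) :
    ∫ x : Fin n → ℂ, (∏ j, ‖x j‖ ^ (2 * α j)) * Real.exp (-t * ∑ j, ‖x j‖ ^ 2)
      = Real.pi ^ n * (∏ j, ((α j).factorial : ℝ)) * (t ^ ((∑ j, α j) + n))⁻¹ := by
  simp_rw [aux_prod_eq]
  rw [integral_fintype_prod_volume_eq_prod
    (fun j (z : ℂ) => ‖z‖ ^ (2 * α j) * Real.exp (-t * ‖z‖ ^ 2))]
  simp_rw [aux_one _ t ht]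
  rw [Finset.prod_mul_distrib, Finset.prod_mul_distrib, Finset.prod_inv_distrib,
    Finset.prod_pow_eq_pow_sum, Finset.sum_add_distrib]
  simp

lemma aux_mp (n : ℕ) : MeasurePreserving
    (fun w : EuclideanSpace ℂ (Fin n) => (WithLp.ofLp w : Fin n → ℂ)) := by
  have hc : Continuous (fun w : EuclideanSpace ℂ (Fin n) => (WithLp.ofLp w : Fin n → ℂ)) :=
    PiLp.continuous_ofLp 2 _
  refine ⟨hc.measurable, ?_⟩
  let e := WithLp.addEquiv 2 (Fin n → ℂ)
  have hH : (Measure.map (fun w : EuclideanSpace ℂ (Fin n) => (WithLp.ofLp w : Fin n → ℂ))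
      volume).IsAddHaarMeasure :=
    AddEquiv.isAddHaarMeasure_map (G := EuclideanSpace ℂ (Fin n)) volume e hc
      (PiLp.continuous_toLp 2 _)
  have hs := Measure.isAddLeftInvariant_eq_smul
    (Measure.map (fun w : EuclideanSpace ℂ (Fin n) => (WithLp.ofLp w : Fin n → ℂ)) volume)
    (volume : Measure (Fin n → ℂ))
  set c := Measure.addHaarScalarFactor
    (Measure.map (fun w : EuclideanSpace ℂ (Fin n) => (WithLp.ofLp w : Fin n → ℂ)) volume)
    (volume : Measure (Fin n → ℂ)) with hcdef
  have h1 : ∫ x : Fin n → ℂ, Real.exp (-1 * ∑ j, ‖x j‖ ^ 2) = Real.pi ^ n := by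
    have := aux_n n 0 1 one_pos
    simpa using this
  have h2 : ∫ x, Real.exp (-1 * ∑ j, ‖x j‖ ^ 2) ∂(Measure.map
      (fun w : EuclideanSpace ℂ (Fin n) => (WithLp.ofLp w : Fin n → ℂ)) volume) = Real.pi ^ n := by
    rw [integral_map hc.measurable.aemeasurable
      (Continuous.aestronglyMeasurable (by fun_prop))]
    have h := GaussianFourier.integral_rexp_neg_mul_sq_norm
      (V := EuclideanSpace ℂ (Fin n)) one_pos
    simp_rw [EuclideanSpace.norm_sq_eq] at h
    rw [h]
    have hf : Module.finrank ℝ (EuclideanSpace ℂ (Fin n)) = 2 * n := by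
      have h3 := finrank_real_of_complex (EuclideanSpace ℂ (Fin n))
      rw [finrank_euclideanSpace_fin] at h3
      exact h3
    rw [hf]
    have : (((2 * n : ℕ) : ℝ) / 2) = n := by push_cast; ring
    rw [this, Real.rpow_natCast, div_one]
  rw [hs, integral_smul_nnreal_measure, h1] at h2
  have hp : (Real.pi : ℝ) ^ n ≠ 0 := by have := Real.pi_pos; positivity
  have h4 : (c : ℝ) = 1 := by
    rw [NNReal.smul_def, smul_eq_mul] at h2
    exact mul_right_cancel₀ hp (by rw [h2, one_mul])
  have h5 : c = 1 := by exact_mod_cast h4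
  rw [hs, h5, one_smul]

lemma aux_me (n : ℕ) : MeasurableEmbedding
    (fun w : EuclideanSpace ℂ (Fin n) => (WithLp.ofLp w : Fin n → ℂ)) :=
  (PiLp.homeomorph 2 (fun _ : Fin n => ℂ)).measurableEmbedding

/-- The diagonal case in real form. -/
lemma aux_diag (n l : ℕ) (α : Fin n → ℕ) (hα : (∑ i, α i) = l) :
    ∫ x : Fin n → ℂ, (∏ j, ‖x j‖ ^ (2 * α j)) * ((1 + ∑ j, ‖x j‖ ^ 2) ^ (l + n + 1))⁻¹
      = Real.pi ^ n * (∏ j, ((α j).factorial : ℝ)) / ((n + l).factorial : ℝ) := by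
  set C : ℝ := Real.pi ^ n * (∏ j, ((α j).factorial : ℝ)) with hC
  let F : (Fin n → ℂ) → ℝ → ℝ := fun x t =>
    (t ^ (l + n) * Real.exp (-t)) *
      ((∏ j, ‖x j‖ ^ (2 * α j)) * Real.exp (-t * ∑ j, ‖x j‖ ^ 2))
  have hexp : ∫ t in Set.Ioi (0 : ℝ), Real.exp (-t) = 1 := integral_exp_neg_Ioi_zero
  have hin : ∀ t : ℝ, 0 < t → ∫ x, F x t = C * Real.exp (-t) := by
    intro t ht
    simp only [F]
    rw [integral_const_mul, aux_n n α t ht, hα]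
    have : t ^ (l + n) ≠ 0 := by positivity
    rw [← hC]
    field_simp
  have hFn : ∀ x t, 0 < t → 0 ≤ F x t := by
    intro x t ht
    simp only [F]
    positivity
  have hI : Integrable (Function.uncurry F) (volume.prod (volume.restrict (Set.Ioi 0))) := by
    rw [integrable_prod_iff']
    · constructor
      · refine (ae_restrict_iff' measurableSet_Ioi).2 (Filter.Eventually.of_forall ?_)
        intro t ht
        exact (aux_n_int n α t ht).const_mul (t ^ (l + n) * Real.exp (-t))
      · have : IntegrableOn (fun t : ℝ => C * Real.exp (-t)) (Set.Ioi 0) :=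
          (integrableOn_exp_neg_Ioi 0).const_mul C
        refine IntegrableOn.congr_fun this ?_ measurableSet_Ioi
        intro t ht
        simp only [Function.uncurry]
        rw [← hin t ht]
        congr 1
        ext x
        rw [Real.norm_of_nonneg (hFn x t ht)]
    · apply Continuous.aestronglyMeasurable
      simp only [F, Function.uncurry_def]
      fun_prop
  have hsw := integral_integral_swap hI
  have hR : ∫ t in Set.Ioi (0 : ℝ), ∫ x, F x t = C := by
    rw [setIntegral_congr_fun measurableSet_Ioi (g := fun t => C * Real.exp (-t))
      (fun t ht => hin t ht), integral_const_mul, hexp, mul_one]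
  have hL : ∀ x, ∫ t in Set.Ioi (0 : ℝ), F x t = ((n + l).factorial : ℝ) *
      ((∏ j, ‖x j‖ ^ (2 * α j)) * ((1 + ∑ j, ‖x j‖ ^ 2) ^ (l + n + 1))⁻¹) := by
    intro x
    have hr : 0 < 1 + ∑ j, ‖x j‖ ^ 2 := by positivity
    have h := Real.integral_rpow_mul_exp_neg_mul_Ioi (a := ((l + n + 1 : ℕ) : ℝ))
      (by positivity) hr
    have e : (((l + n + 1 : ℕ) : ℝ) - 1) = ((l + n : ℕ) : ℝ) := by push_cast; ring
    have e' : ((l + n + 1 : ℕ) : ℝ) = ((l + n : ℕ) : ℝ) + 1 := by push_cast; ring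
    rw [e, Real.rpow_natCast] at h
    rw [e', Real.Gamma_nat_eq_factorial] at h
    simp only [Real.rpow_natCast] at h
    have : ∀ t, F x t = (∏ j, ‖x j‖ ^ (2 * α j)) *
        (t ^ (l + n) * Real.exp (-((1 + ∑ j, ‖x j‖ ^ 2) * t))) := by
      intro t
      have : Real.exp (-((1 + ∑ j, ‖x j‖ ^ 2) * t))
          = Real.exp (-t) * Real.exp (-t * ∑ j, ‖x j‖ ^ 2) := by
        rw [← Real.exp_add]; congr 1; ring
      simp only [F]
      rw [this]; ring
    simp_rw [this]
    rw [integral_const_mul, h, one_div, inv_pow, add_comm n l]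
    ring
  simp_rw [hL] at hsw
  rw [integral_const_mul, hR] at hsw
  have hf : ((n + l).factorial : ℝ) ≠ 0 := by positivity
  rw [eq_div_iff hf, mul_comm]
  exact hsw

lemma aux_off (n N : ℕ) (α β : Fin n → ℕ) (hne : α ≠ β) :
    ∫ x : Fin n → ℂ, (∏ j, x j ^ α j) * (∏ j, (starRingEnd ℂ) (x j) ^ β j) *
          (((1 + ∑ j, ‖x j‖ ^ 2) ^ N : ℝ) : ℂ)⁻¹ = 0 := by
  obtain ⟨k, hk⟩ := Function.ne_iff.1 hne
  have hk' : ((α k : ℝ) - β k) ≠ 0 := sub_ne_zero.2 (by exact_mod_cast hk)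
  let u : Circle := Circle.exp (Real.pi / ((α k : ℝ) - β k))
  have hu : (u : ℂ) ^ α k * (starRingEnd ℂ) (u : ℂ) ^ β k = -1 := by
    have hkc : ((α k : ℂ) - β k) ≠ 0 := by exact_mod_cast hk'
    simp only [u, Circle.coe_exp]
    rw [← Complex.exp_conj, ← Complex.exp_nat_mul, ← Complex.exp_nat_mul, ← Complex.exp_add,
      ← Complex.exp_pi_mul_I]
    congr 1
    simp
    field_simp
    ring
  let v : Fin n → Circle := fun j => if j = k then u else 1
  have hv : (∏ j, (v j : ℂ) ^ α j) * (∏ j, (starRingEnd ℂ) (v j : ℂ) ^ β j) = -1 := by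
    rw [← Finset.prod_mul_distrib, Finset.prod_eq_single k]
    · simpa [v] using hu
    · intro j _ hj
      simp [v, hj]
    · simp
  have hmp : MeasurePreserving (fun (x : Fin n → ℂ) j => rotation (v j) (x j)) volume volume :=
    volume_preserving_pi (fun j => (rotation (v j)).measurePreserving)
  let e : (Fin n → ℂ) ≃ᵐ (Fin n → ℂ) :=
    MeasurableEquiv.piCongrRight (fun j => (rotation (v j)).toHomeomorph.toMeasurableEquiv)
  have hmp' : MeasurePreserving e volume volume := hmp
  have h := hmp'.integral_comp' (fun x : Fin n → ℂ => (∏ j, x j ^ α j) *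
    (∏ j, (starRingEnd ℂ) (x j) ^ β j) * (((1 + ∑ j, ‖x j‖ ^ 2) ^ N : ℝ) : ℂ)⁻¹)
  have he : ∀ x j, e x j = (v j : ℂ) * x j := fun x j => rotation_apply (v j) (x j)
  simp only [he] at h
  have h2 : ∀ x : Fin n → ℂ, (∏ j, ((v j : ℂ) * x j) ^ α j) *
    (∏ j, (starRingEnd ℂ) ((v j : ℂ) * x j) ^ β j) *
      (((1 + ∑ j, ‖(v j : ℂ) * x j‖ ^ 2) ^ N : ℝ) : ℂ)⁻¹ =
      (-1) * ((∏ j, x j ^ α j) *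
    (∏ j, (starRingEnd ℂ) (x j) ^ β j) * (((1 + ∑ j, ‖x j‖ ^ 2) ^ N : ℝ) : ℂ)⁻¹) := by
    intro x
    rw [← hv]
    simp only [mul_pow, map_mul, Finset.prod_mul_distrib, norm_mul, Circle.norm_coe, one_mul]
    ring
  simp_rw [h2] at h
  rw [integral_const_mul] at h
  linear_combination (-1 / 2 : ℂ) * h


/-- The monomial integral over `ℂⁿ`:
`∫_{ℂⁿ} w^α conj(w)^β (1+|w|²)^{−(l+n+1)} dm(w) = πⁿ α!/(n+l)!` if `α = β`
(with `|α| = |β| = l`), and `= 0` otherwise. -/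
theorem stmt19 (n : ℕ) (hn : 1 ≤ n) (l : ℕ) (α β : Fin n → ℕ)
    (hα : (∑ i, α i) = l) (hβ : (∑ i, β i) = l) :
    (∫ w : EuclideanSpace ℂ (Fin n),
        (∏ j, w j ^ α j) * (∏ j, (starRingEnd ℂ) (w j) ^ β j) *
          (((1 + ‖w‖ ^ 2) ^ (l + n + 1) : ℝ) : ℂ)⁻¹)
      = if α = β then
          ((Real.pi ^ n * (∏ j, (Nat.factorial (α j) : ℝ)) /
            (Nat.factorial (n + l) : ℝ) : ℝ) : ℂ)
        else 0 := by

  have hT := (aux_mp n).integral_comp (aux_me n) (fun x : Fin n → ℂ => (∏ j, x j ^ α j) *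
    (∏ j, (starRingEnd ℂ) (x j) ^ β j) *
      (((1 + ∑ j, ‖x j‖ ^ 2) ^ (l + n + 1) : ℝ) : ℂ)⁻¹)
  simp_rw [EuclideanSpace.norm_sq_eq]
  refine hT.trans ?_
  split_ifs with h
  · subst h
    rw [← aux_diag n l α hα, ← integral_complex_ofReal]
    congr 1
    ext x
    rw [← Finset.prod_mul_distrib]
    push_cast
    congr 1
    refine Finset.prod_congr rfl fun j _ => ?_
    rw [← mul_pow, Complex.mul_conj', pow_mul]
  · exact aux_off n _ α β h
end
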